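/- arXiv:2501.01712 — 4 statements merged into one kernel-verified Lean document; each statement's English description precedes it below -/
import Mathlib

section
/- Let μ be a probability measure on a countable group G such that the semigroup ⟨supp μ⟩₊ generated by the support of μ contains a finitely generated subgroup of at least cubic growth. Let {μ_k}_{k≥1} be probability measures on G with μ_k(g) → μ(g) as k → ∞ for every g ∈ G. Then p_esc(μ_k) → p_esc(μ) as k → ∞. -/
open Filter

namespace RW


variable {G : Type*} [Group G]

/-- `μ` is a probability mass function on the countable group `G`. -/
def IsProb (μ : G → ℝ) : Prop := (∀ g, 0 ≤ μ g) ∧ HasSum μ 1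

/-- Convolution of two measures: `(μ * ν)(g) = ∑_h μ(g h⁻¹) ν(h)`. -/
noncomputable def conv (μ ν : G → ℝ) : G → ℝ := fun g => ∑' h : G, μ (g * h⁻¹) * ν h

open Classical in
/-- `n`-fold convolution power of `μ`; `convPow μ 0` is the Dirac mass at the identity. -/
noncomputable def convPow (μ : G → ℝ) : ℕ → G → ℝ
  | 0 => fun g => if g = 1 then (1 : ℝ) else 0
  | n + 1 => conv (convPow μ n) μ

/-- Shannon entropy `H(μ) = -∑_g μ(g) log μ(g)`. -/
noncomputable def entropy (μ : G → ℝ) : ℝ := ∑' g : G, Real.negMulLog (μ g)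

/-- `H(μ) < ∞`. -/
def FiniteEntropy (μ : G → ℝ) : Prop := Summable fun g : G => Real.negMulLog (μ g)

/-- Asymptotic entropy `h(μ) = lim_n H(μ^{*n})/n` (the limit exists by subadditivity,
so it coincides with the `limsup`). -/
noncomputable def asympEntropy (μ : G → ℝ) : ℝ :=
  Filter.limsup (fun n : ℕ => entropy (convPow μ n) / (n : ℝ)) Filter.atTop

/-- Position of the random walk at time `m`, given the sequence of increments `gs`
(0-indexed: the `i`-th increment is `g_{i+1} = gs i`), so `walk gs m = g_1 ⋯ g_m`. -/
def walk (gs : ℕ → G) (m : ℕ) : G := ((List.range m).map gs).prod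

/-- Extend a finite tuple of increments to an infinite sequence, padding by `1`. -/
noncomputable def pad {n : ℕ} (gs : Fin n → G) : ℕ → G :=
  fun i => if h : i < n then gs ⟨i, h⟩ else 1

/-- Probability, for the random walk with step distribution `μ`, of an event `E` about the
increment sequence that only depends on the first `n` increments. -/
noncomputable def cylProb (μ : G → ℝ) (n : ℕ) (E : Set (ℕ → G)) : ℝ :=
  ∑' gs : Fin n → G,
    Set.indicator {v : Fin n → G | pad v ∈ E} (fun v => ∏ i, μ (v i)) gs

/-- Escape probability `p_esc(μ) = P(w_m ≠ e for all m ≥ 1)`: the (decreasing) limit,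
i.e. the infimum, of the probabilities of not returning to the identity up to time `n`. -/
noncomputable def escapeProb (μ : G → ℝ) : ℝ :=
  ⨅ n : ℕ, cylProb μ n {gs | ∀ m, 1 ≤ m → m ≤ n → walk gs m ≠ 1}

/-- The `μ`-random walk is transient. -/
def Transient (μ : G → ℝ) : Prop := 0 < escapeProb μ

/-- The subsemigroup generated by the support of `μ`, as a set. -/
def suppSemigroup (μ : G → ℝ) : Set G :=
  (Subsemigroup.closure (Function.support μ) : Subsemigroup G)

/-- `μ` is non-degenerate: the semigroup generated by its support is all of `G`. -/
def NonDegenerate (μ : G → ℝ) : Prop := ∀ g : G, g ∈ suppSemigroup μ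

/-- The semigroup generated by the support of `μ` is symmetric (closed under inversion). -/
def SymmetricSemigroup (μ : G → ℝ) : Prop := ∀ g ∈ suppSemigroup μ, g⁻¹ ∈ suppSemigroup μ

/-- Law of a random variable `X` of the increment sequence that only depends on the
first `n` increments. -/
noncomputable def law (μ : G → ℝ) (n : ℕ) {D : Type*} (X : (ℕ → G) → D) : D → ℝ :=
  fun d => cylProb μ n {gs | X gs = d}

/-- Shannon entropy `H_μ(X)` of a random variable `X` of the increment sequence that only
depends on the first `n` increments. -/
noncomputable def entropyRV (μ : G → ℝ) (n : ℕ) {D : Type*} (X : (ℕ → G) → D) : ℝ :=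
  ∑' d : D, Real.negMulLog (law μ n X d)

/-- Conditional entropy `H_μ(X | Y) = H_μ(X, Y) - H_μ(Y)`. -/
noncomputable def condEntropyRV (μ : G → ℝ) (n : ℕ) {D E : Type*}
    (X : (ℕ → G) → D) (Y : (ℕ → G) → E) : ℝ :=
  entropyRV μ n (fun gs => (X gs, Y gs)) - entropyRV μ n Y

/-- Expectation `E_μ(X)` of a real random variable `X` of the increment sequence that only
depends on the first `n` increments. -/
noncomputable def expect (μ : G → ℝ) (n : ℕ) (X : (ℕ → G) → ℝ) : ℝ :=
  ∑' gs : Fin n → G, (∏ i, μ (gs i)) * X (pad gs)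

/-- The `t₀`-coarse trajectory at instant `n`: `(w_{t₀}, w_{2t₀}, …, w_{⌊n/t₀⌋t₀})`. -/
def coarseTraj (t₀ n : ℕ) (gs : ℕ → G) : Fin (n / t₀) → G :=
  fun j => walk gs ((j.1 + 1) * t₀)

/-- The `n`-ball `(T ∪ {1})^n`: products of `n` elements of `T ∪ {1}`. -/
def ballOf (T : Set G) (n : ℕ) : Set G :=
  {g | ∃ l : List G, l.length = n ∧ (∀ x ∈ l, x ∈ insert (1 : G) T) ∧ l.prod = g}

/-- The set `T` contains a finite symmetric set `S` generating a subgroup whose growth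
function is at least `C n^d`. -/
def GrowthAtLeastWithin (T : Set G) (d : ℝ) : Prop :=
  ∃ S : Finset G, (S : Set G) ⊆ T ∧ (∀ s ∈ S, s⁻¹ ∈ S) ∧
    ∃ C : ℝ, 0 < C ∧ ∀ n : ℕ, 1 ≤ n →
      C * (n : ℝ) ^ d ≤ ((ballOf (S : Set G) n).ncard : ℝ)

/-- `P_μ(∃ ℓ > n₀, w_ℓ ∈ F)`: the (increasing) limit, i.e. the supremum, over finite
horizons `m` of the probability of visiting `F` at some time in `(n₀, m]`. -/
noncomputable def returnProbAfter (μ : G → ℝ) (n₀ : ℕ) (F : Set G) : ℝ :=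
  ⨆ m : ℕ, cylProb μ m {gs | ∃ ℓ, n₀ < ℓ ∧ ℓ ≤ m ∧ walk gs ℓ ∈ F}

/-- The set of `(n₀,t₀,F)`-unstable points at instant `n`. -/
def unstablePts (n₀ t₀ n : ℕ) (F : Set G) (gs : ℕ → G) : Set G :=
  {b | ∃ j, j ≤ n / t₀ - n₀ ∧ ∃ ℓ, ℓ ≤ n / t₀ ∧ j + n₀ < ℓ ∧
    (∃ f ∈ F, walk gs (j * t₀) * f = b) ∧ (∃ f ∈ F, walk gs (ℓ * t₀) * f = b)}

/-- The set of visits to `(n₀,t₀,F)`-unstable points by time `n`. -/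
def unstableVisits (n₀ t₀ n : ℕ) (F : Set G) (gs : ℕ → G) : Set ℕ :=
  {j | j ≤ n / t₀ - n₀ ∧ ∃ b ∈ unstablePts n₀ t₀ n F gs, ∃ f ∈ F, walk gs (j * t₀) * f = b}

/-- Product measure `μ^{t₀}` of a subset of `G^{t₀}`. -/
noncomputable def prodMeas (μ : G → ℝ) (t₀ : ℕ) (E : Set (Fin t₀ → G)) : ℝ :=
  ∑' v : Fin t₀ → G, Set.indicator E (fun v => ∏ i, μ (v i)) v

open Classical in
/-- The random variable `W̃`: the tuple of the first `t₀` increments if the event `E`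
occurs, and the extra symbol `⋆` (here `none`) otherwise. -/
noncomputable def obscure {t₀ : ℕ} (E : Set (Fin t₀ → G)) (gs : ℕ → G) :
    Option (Fin t₀ → G) :=
  if (fun i : Fin t₀ => gs i.1) ∈ E then some (fun i : Fin t₀ => gs i.1) else none

/-- A group `H` is ICC if it is non-trivial and every non-identity element has an
infinite conjugacy class. -/
def IsICC (H : Type*) [Group H] : Prop :=
  Nontrivial H ∧ ∀ h : H, h ≠ 1 → (Set.range fun g : H => g * h * g⁻¹).Infinite

/-- A group is hyper-FC-central if it has no non-trivial ICC quotient. -/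
def HyperFCCentral (G : Type*) [Group G] : Prop :=
  ∀ (N : Subgroup G) [N.Normal], ¬ IsICC (G ⧸ N)


section Averaging

open scoped ENNReal

/-- The transition operator of the right random walk with step distribution `μ`. -/
noncomputable def avg (μ f : G → ℝ≥0∞) (x : G) : ℝ≥0∞ := ∑' g, μ g * f (x * g)

open Classical in
/-- The indicator function of the identity. -/
noncomputable def dirac (x : G) : ℝ≥0∞ := if x = 1 then 1 else 0

/-- The probability that the walk started at `x` is at the identity at time `n`. -/
noncomputable def hitProb (μ : G → ℝ≥0∞) (n : ℕ) : G → ℝ≥0∞ := (avg μ)^[n] dirac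

/-- The expected number of visits to the identity of the walk started at `x`. -/
noncomputable def green (μ : G → ℝ≥0∞) (x : G) : ℝ≥0∞ := ∑' n, hitProb μ n x

/-- The law of the walk at an independent geometric time. -/
noncomputable def geomStop (μ : G → ℝ≥0∞) (g : G) : ℝ≥0∞ :=
  ∑' n, (2⁻¹ : ℝ≥0∞) ^ (n + 1) * hitProb μ n g⁻¹

lemma avg_mono (μ : G → ℝ≥0∞) {f h : G → ℝ≥0∞} (hfh : f ≤ h) : avg μ f ≤ avg μ h :=
  fun x => ENNReal.tsum_le_tsum fun g => mul_le_mul_right (hfh (x * g)) (μ g)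

lemma avg_add (μ f h : G → ℝ≥0∞) : avg μ (f + h) = avg μ f + avg μ h := by
  ext x; simp [avg, mul_add, ENNReal.tsum_add]

lemma avg_tsum (μ : G → ℝ≥0∞) (f : ℕ → G → ℝ≥0∞) (x : G) :
    avg μ (fun y => ∑' n, f n y) x = ∑' n, avg μ (f n) x := by
  simp only [avg, ← ENNReal.tsum_mul_left]
  exact ENNReal.tsum_comm

lemma avg_const_mul (μ : G → ℝ≥0∞) (a : ℝ≥0∞) (f : G → ℝ≥0∞) (x : G) :
    avg μ (fun y => a * f y) x = a * avg μ f x := by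
  simp only [avg, ← ENNReal.tsum_mul_left, mul_left_comm]

lemma avg_sum (μ : G → ℝ≥0∞) (f : ℕ → G → ℝ≥0∞) (N : ℕ) (x : G) :
    avg μ (fun y => ∑ n ∈ Finset.range N, f n y) x = ∑ n ∈ Finset.range N, avg μ (f n) x := by
  simp only [avg, Finset.mul_sum]
  exact Summable.tsum_finsetSum fun _ _ => ENNReal.summable

lemma avg_iterate_add (μ f h : G → ℝ≥0∞) (n : ℕ) :
    (avg μ)^[n] (f + h) = (avg μ)^[n] f + (avg μ)^[n] h := by
  induction n with
  | zero => rfl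
  | succ n ih => simp only [Function.iterate_succ_apply', ih, avg_add]

lemma hitProb_zero (μ : G → ℝ≥0∞) : hitProb μ 0 = dirac := rfl

lemma hitProb_succ (μ : G → ℝ≥0∞) (n : ℕ) : hitProb μ (n + 1) = avg μ (hitProb μ n) :=
  Function.iterate_succ_apply' _ _ _

lemma tsum_avg (μ f : G → ℝ≥0∞) : ∑' x, avg μ f x = (∑' g, μ g) * ∑' x, f x := by
  simp only [avg]
  rw [ENNReal.tsum_comm, ← ENNReal.tsum_mul_right]
  refine tsum_congr fun g => ?_
  rw [ENNReal.tsum_mul_left]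
  congr 1
  exact (Equiv.mulRight g).tsum_eq f

lemma tsum_hitProb {μ : G → ℝ≥0∞} (hμ : ∑' g, μ g = 1) (n : ℕ) :
    ∑' x, hitProb μ n x = 1 := by
  induction n with
  | zero => simp [hitProb_zero, dirac, tsum_ite_eq]
  | succ n ih => rw [hitProb_succ, tsum_avg, hμ, ih, one_mul]

lemma tsum_hitProb_inv {μ : G → ℝ≥0∞} (hμ : ∑' g, μ g = 1) (n : ℕ) :
    ∑' x, hitProb μ n x⁻¹ = 1 := by
  rw [← tsum_hitProb hμ n]
  exact (Equiv.inv G).tsum_eq (hitProb μ n)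

lemma hitProb_le_one {μ : G → ℝ≥0∞} (hμ : ∑' g, μ g = 1) (n : ℕ) (x : G) :
    hitProb μ n x ≤ 1 := by
  rw [← tsum_hitProb hμ n]
  exact ENNReal.le_tsum x

lemma avg_iterate (μ f : G → ℝ≥0∞) (n : ℕ) (x : G) :
    (avg μ)^[n] f x = ∑' y, hitProb μ n y⁻¹ * f (x * y) := by
  induction n generalizing x with
  | zero =>
    rw [tsum_eq_single 1]
    · simp [hitProb_zero, dirac]
    · intro y hy
      simp [hitProb_zero, dirac, hy]
  | succ n ih =>
    rw [Function.iterate_succ_apply', hitProb_succ]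
    simp only [avg, ih, ← ENNReal.tsum_mul_left, ← ENNReal.tsum_mul_right]
    conv_rhs => rw [ENNReal.tsum_comm]
    refine tsum_congr fun g => ?_
    conv_rhs => rw [← (Equiv.mulLeft g).tsum_eq]
    refine tsum_congr fun y => ?_
    simp [mul_assoc]

lemma hitProb_add (μ : G → ℝ≥0∞) (m n : ℕ) (x : G) :
    hitProb μ (m + n) x = ∑' y, hitProb μ m y⁻¹ * hitProb μ n (x * y) := by
  rw [← avg_iterate, hitProb, hitProb, Function.iterate_add_apply]

lemma green_eq (μ : G → ℝ≥0∞) : green μ = dirac + avg μ (green μ) := by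
  ext x
  have h := avg_tsum μ (hitProb μ) x
  simp only [← hitProb_succ] at h
  rw [Pi.add_apply]
  change _ = _ + avg μ (fun y => ∑' n, hitProb μ n y) x
  rw [h, green, tsum_eq_zero_add' ENNReal.summable, hitProb_zero]

lemma green_le {μ h : G → ℝ≥0∞} (hh : dirac + avg μ h ≤ h) : green μ ≤ h := by
  have key : ∀ N : ℕ, (fun x => ∑ n ∈ Finset.range N, hitProb μ n x) ≤ h := by
    intro N
    induction N with
    | zero => intro x; simp
    | succ N ih =>
      refine le_trans (fun x => ?_) hh
      simp only [Finset.sum_range_succ', hitProb_succ, ← avg_sum, hitProb_zero]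
      rw [add_comm]
      exact add_le_add_right (avg_mono μ ih x) _
  exact fun x => ENNReal.tsum_le_of_sum_range_le fun N => key N x

lemma avg_geomStop (μ f : G → ℝ≥0∞) (x : G) :
    avg (geomStop μ) f x = ∑' n, (2⁻¹ : ℝ≥0∞) ^ (n + 1) * (avg μ)^[n] f x := by
  simp only [avg_iterate, ← ENNReal.tsum_mul_left]
  simp only [avg, geomStop, ← ENNReal.tsum_mul_right]
  rw [ENNReal.tsum_comm]
  simp only [mul_assoc]

lemma avg_geomStop_eq (μ f : G → ℝ≥0∞) (x : G) :
    avg (geomStop μ) f x = 2⁻¹ * f x + 2⁻¹ * avg μ (avg (geomStop μ) f) x := by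
  have h : avg (geomStop μ) f = fun x => ∑' n, (2⁻¹ : ℝ≥0∞) ^ (n + 1) * (avg μ)^[n] f x :=
    funext (avg_geomStop μ f)
  conv_rhs => rw [h]
  rw [avg_tsum, avg_geomStop, tsum_eq_zero_add' ENNReal.summable, ← ENNReal.tsum_mul_left]
  simp_rw [Function.iterate_succ_apply']
  simp [avg_const_mul, pow_succ', mul_assoc]

lemma inv_two_mul_add_self (a : ℝ≥0∞) : 2⁻¹ * (a + a) = a := by
  rw [← two_mul, ← mul_assoc, ENNReal.inv_mul_cancel (by simp) (by simp), one_mul]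

/-- Stopping the walk at independent geometric times adds exactly one visit on average. -/
lemma green_geomStop (μ : G → ℝ≥0∞) : green (geomStop μ) = dirac + green μ := by
  apply le_antisymm
  · apply green_le
    gcongr
    intro x
    rw [avg_geomStop]
    refine ENNReal.tsum_le_of_sum_range_le fun N => ?_
    have key : ∑ n ∈ Finset.range N, (2⁻¹ : ℝ≥0∞) ^ (n + 1) * (avg μ)^[n] (dirac + green μ) x
        + 2⁻¹ ^ N * (avg μ)^[N] (green μ) x = green μ x := by
      induction N with
      | zero => simp
      | succ N ih =>
        rw [← ih, Finset.sum_range_succ, add_assoc]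
        congr 1
        have h1 : (avg μ)^[N] (green μ) = (avg μ)^[N] dirac + (avg μ)^[N + 1] (green μ) := by
          conv_lhs => rw [green_eq, avg_iterate_add]
          rw [Function.iterate_succ_apply]
        rw [avg_iterate_add]
        conv_rhs => rw [← inv_two_mul_add_self ((avg μ)^[N] (green μ) x)]
        conv_rhs => enter [2, 2, 1]; rw [h1]
        simp only [Pi.add_apply]
        ring
    exact le_trans le_self_add key.le
  · rw [green_eq (geomStop μ)]
    gcongr
    apply green_le
    intro x
    set g := avg (geomStop μ) (green (geomStop μ)) with hg
    rcases eq_or_ne (g x) ⊤ with h | h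
    · rw [h]; exact le_top
    have h1 : g x = 2⁻¹ * green (geomStop μ) x + 2⁻¹ * avg μ g x := avg_geomStop_eq _ _ x
    have h2 : green (geomStop μ) x = dirac x + g x := congrFun (green_eq _) x
    rw [h2, ← mul_add] at h1
    have h3 : g x + g x = g x + (dirac x + avg μ g x) := by
      calc g x + g x = 2 * g x := (two_mul _).symm
        _ = 2 * (2⁻¹ * (dirac x + g x + avg μ g x)) := by rw [← h1]
        _ = dirac x + g x + avg μ g x := by
          rw [← mul_assoc, ENNReal.mul_inv_cancel (by simp) (by simp), one_mul]
        _ = _ := by ring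
    exact ((ENNReal.add_right_inj h).1 h3).ge

lemma tsum_inv_two_pow_succ : ∑' n : ℕ, (2⁻¹ : ℝ≥0∞) ^ (n + 1) = 1 := by
  simp only [pow_succ, ENNReal.tsum_mul_right, ENNReal.tsum_geometric, ENNReal.one_sub_inv_two,
    inv_inv]
  exact ENNReal.mul_inv_cancel (by simp) (by simp)

lemma tsum_geomStop {μ : G → ℝ≥0∞} (hμ : ∑' g, μ g = 1) : ∑' g, geomStop μ g = 1 := by
  simp only [geomStop]
  rw [ENNReal.tsum_comm]
  simp only [ENNReal.tsum_mul_left, tsum_hitProb_inv hμ, mul_one, tsum_inv_two_pow_succ]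

lemma geomStop_one_ne_zero (μ : G → ℝ≥0∞) : geomStop μ 1 ≠ 0 := by
  intro h
  have := ENNReal.tsum_eq_zero.1 h 0
  simp [hitProb_zero, dirac] at this

lemma geomStop_ne_zero {μ : G → ℝ≥0∞} {g : G} {n : ℕ} (h : hitProb μ n g⁻¹ ≠ 0) :
    geomStop μ g ≠ 0 := by
  intro h'
  have := ENNReal.tsum_eq_zero.1 h' n
  simp [h] at this

lemma exists_hitProb_ne_zero {μ : G → ℝ≥0∞} {g : G}
    (hg : g ∈ Subsemigroup.closure (Function.support μ)) : ∃ n, hitProb μ n g⁻¹ ≠ 0 := by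
  induction hg using Subsemigroup.closure_induction with
  | mem x hx =>
    refine ⟨1, fun h => hx ?_⟩
    rw [hitProb_succ] at h
    have := ENNReal.tsum_eq_zero.1 h x
    simpa [hitProb_zero, dirac] using this
  | mul x y _ _ hx hy =>
    obtain ⟨m, hm⟩ := hx
    obtain ⟨n, hn⟩ := hy
    refine ⟨m + n, fun h => ?_⟩
    rw [hitProb_add] at h
    have := ENNReal.tsum_eq_zero.1 h x
    simp [hm, hn] at this

end Averaging

section Escape

open scoped ENNReal

open Classical in
/-- The probability that the walk started at `x` avoids the identity at times `1, …, n`. -/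
noncomputable def avoidProb (μ : G → ℝ≥0∞) : ℕ → G → ℝ≥0∞
  | 0 => 1
  | n + 1 => avg μ fun y => if y = 1 then 0 else avoidProb μ n y

lemma walk_succ_eq (gs : ℕ → G) (m : ℕ) :
    walk gs (m + 1) = gs 0 * walk (fun i => gs (i + 1)) m := by
  simp [walk, List.range_succ_eq_map, Function.comp_def]

lemma walk_pad_cons {n : ℕ} (g : G) (v : Fin n → G) (m : ℕ) :
    walk (pad (Fin.cons g v : Fin (n + 1) → G)) (m + 1) = g * walk (pad v) m := by
  rw [walk_succ_eq]
  congr 1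
  congr 1
  ext i
  by_cases h : i < n
  · rw [pad, pad, dif_pos (Nat.succ_lt_succ h), dif_pos h]
    exact Fin.cons_succ (α := fun _ => G) g v ⟨i, h⟩
  · simp [pad, h]

lemma tsum_indicator_avoid (μ : G → ℝ≥0∞) (n : ℕ) (x : G) :
    ∑' v : Fin n → G, Set.indicator {v | ∀ m, 1 ≤ m → m ≤ n → x * walk (pad v) m ≠ 1}
      (fun v => ∏ i, μ (v i)) v = avoidProb μ n x := by
  classical
  induction n generalizing x with
  | zero =>
    rw [tsum_eq_single default (fun v hv => (hv (Subsingleton.elim _ _)).elim)]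
    rw [Set.indicator_of_mem]
    · simp [avoidProb]
    · intro m h1 h2
      omega
  | succ n ih =>
    rw [← (Fin.consEquiv (fun _ : Fin (n + 1) => G)).tsum_eq, ENNReal.tsum_prod', avoidProb, avg]
    refine tsum_congr fun g => ?_
    by_cases hg : x * g = 1
    · rw [if_pos hg, mul_zero, ENNReal.tsum_eq_zero]
      intro v
      refine Set.indicator_of_notMem (fun h => ?_) _
      refine h 1 le_rfl (by omega) ?_
      change x * walk (pad (Fin.cons g v : Fin (n + 1) → G)) (0 + 1) = 1
      rw [walk_pad_cons]
      simpa [walk] using hg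
    · rw [if_neg hg, ← ih, ← ENNReal.tsum_mul_left]
      refine tsum_congr fun v => ?_
      change Set.indicator _ _ (Fin.cons g v : Fin (n + 1) → G) = _
      simp only [Set.indicator_apply, Set.mem_ofPred_eq, mul_ite, mul_zero, Fin.prod_univ_succ,
        Fin.cons_zero, Fin.cons_succ]
      refine if_congr ⟨fun h m h1 h2 => ?_, fun h m h1 h2 => ?_⟩ rfl rfl
      · have := h (m + 1) (by omega) (by omega)
        rwa [walk_pad_cons, ← mul_assoc] at this
      · obtain ⟨m, rfl⟩ : ∃ k, m = k + 1 := ⟨m - 1, by omega⟩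
        rw [walk_pad_cons, ← mul_assoc]
        rcases Nat.eq_zero_or_pos m with rfl | hm
        · simpa [walk] using hg
        · exact h m hm (by omega)

lemma avoidProb_succ_le {μ : G → ℝ≥0∞} (hμ : ∑' g, μ g = 1) (n : ℕ) :
    avoidProb μ (n + 1) ≤ avoidProb μ n := by
  classical
  induction n with
  | zero =>
    intro x
    rw [avoidProb, avoidProb, avg, Pi.one_apply, ← hμ]
    refine ENNReal.tsum_le_tsum fun g => ?_
    split_ifs
    · simp
    · simp [avoidProb]
  | succ n ih =>
    rw [avoidProb, avoidProb]
    refine avg_mono μ fun y => ?_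
    dsimp only
    split_ifs
    · exact le_rfl
    · exact ih y

lemma avoidProb_le_one {μ : G → ℝ≥0∞} (hμ : ∑' g, μ g = 1) (n : ℕ) (x : G) :
    avoidProb μ n x ≤ 1 :=
  antitone_nat_of_succ_le (avoidProb_succ_le hμ) (Nat.zero_le n) x

open Classical in
/-- Decomposition according to the last visit to the identity up to time `N`. -/
lemma sum_hitProb_mul_avoidProb {μ : G → ℝ≥0∞} (hμ : ∑' g, μ g = 1) (N : ℕ) (x : G) :
    ∑ m ∈ Finset.range (N + 1), hitProb μ m x * avoidProb μ (N - m) 1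
      + (if x = 1 then 0 else avoidProb μ N x) = 1 := by
  induction N generalizing x with
  | zero => by_cases hx : x = 1 <;> simp [hitProb_zero, dirac, avoidProb, hx]
  | succ N ih =>
    have h1 : ∑ m ∈ Finset.range (N + 1), hitProb μ (m + 1) x * avoidProb μ (N - m) 1
        + avoidProb μ (N + 1) x = 1 := by
      rw [← hμ]
      conv_rhs => enter [1, g]; rw [← mul_one (μ g), ← ih (x * g)]
      have h2 : ∀ m, hitProb μ (m + 1) x * avoidProb μ (N - m) 1
          = avg μ (fun y => avoidProb μ (N - m) 1 * hitProb μ m y) x := fun m => by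
        rw [avg_const_mul, hitProb_succ, mul_comm]
      simp only [h2, mul_add, ENNReal.tsum_add]
      rw [← avg_sum]
      simp only [avoidProb, avg, mul_comm]
    rw [Finset.sum_range_succ']
    simp only [Nat.add_sub_add_right, Nat.sub_zero]
    by_cases hx : x = 1
    · rw [← h1]
      simp [hitProb_zero, dirac, hx]
    · rw [← h1]
      simp [hitProb_zero, dirac, hx]

lemma tsum_ofReal_eq_one {α : Type*} {μ : α → ℝ} (hμ : IsProb μ) :
    ∑' g, ENNReal.ofReal (μ g) = 1 := by
  rw [← ENNReal.ofReal_tsum_of_nonneg hμ.1 hμ.2.summable, hμ.2.tsum_eq, ENNReal.ofReal_one]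

lemma cylProb_avoid {μ : G → ℝ} (hμ : IsProb μ) (n : ℕ) :
    cylProb μ n {gs | ∀ m, 1 ≤ m → m ≤ n → walk gs m ≠ 1}
      = (avoidProb (fun g => ENNReal.ofReal (μ g)) n 1).toReal := by
  classical
  rw [← tsum_indicator_avoid, ENNReal.tsum_toReal_eq, cylProb]
  · refine tsum_congr fun v => ?_
    simp only [Set.indicator_apply, Set.mem_ofPred_eq, one_mul]
    split_ifs
    · simp [ENNReal.toReal_prod, ENNReal.toReal_ofReal (hμ.1 _)]
    · rfl
  · intro v
    rw [Set.indicator_apply]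
    split_ifs
    · exact ENNReal.prod_ne_top fun i _ => ENNReal.ofReal_ne_top
    · exact ENNReal.zero_ne_top

/-- The escape probability is the inverse of the expected number of visits. -/
lemma escapeProb_mul_green {μ : G → ℝ} (hμ : IsProb μ)
    (hfin : green (fun g => ENNReal.ofReal (μ g)) 1 ≠ ⊤) :
    escapeProb μ * (green (fun g => ENNReal.ofReal (μ g)) 1).toReal = 1 := by
  set M : G → ℝ≥0∞ := fun g => ENNReal.ofReal (μ g) with hM
  have hM1 : ∑' g, M g = 1 := tsum_ofReal_eq_one hμ
  set q : ℕ → ℝ := fun n => (avoidProb M n 1).toReal with hq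
  set u : ℕ → ℝ := fun n => (hitProb M n 1).toReal with hu
  have hqtop : ∀ n, avoidProb M n 1 ≠ ⊤ := fun n =>
    ((avoidProb_le_one hM1 n 1).trans_lt ENNReal.one_lt_top).ne
  have hutop : ∀ n, hitProb M n 1 ≠ ⊤ := fun n =>
    ((hitProb_le_one hM1 n 1).trans_lt ENNReal.one_lt_top).ne
  have hq1 : ∀ n, q n ≤ 1 := fun n => by
    simpa using ENNReal.toReal_mono ENNReal.one_ne_top (avoidProb_le_one hM1 n 1)
  have hq0 : ∀ n, 0 ≤ q n := fun n => ENNReal.toReal_nonneg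
  have hlim : Tendsto q atTop (nhds (escapeProb μ)) := by
    have : escapeProb μ = ⨅ n, q n := by simp only [escapeProb, cylProb_avoid hμ, hq, hM]
    rw [this]
    refine tendsto_atTop_ciInf (antitone_nat_of_succ_le fun n => ?_) ⟨0, ?_⟩
    · exact ENNReal.toReal_mono (hqtop n) (avoidProb_succ_le hM1 n 1)
    · rintro _ ⟨n, rfl⟩
      exact hq0 n
  have hus : Summable u := ENNReal.summable_toReal hfin
  have hsum : ∀ N, ∑' m, (if m < N + 1 then u m * q (N - m) else 0) = 1 := by
    intro N
    rw [tsum_eq_sum (s := Finset.range (N + 1)) (fun m hm => if_neg (by simpa using hm))]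
    have h := sum_hitProb_mul_avoidProb hM1 N 1
    rw [if_pos rfl, add_zero] at h
    have h' := congrArg ENNReal.toReal h
    rw [ENNReal.toReal_sum fun m _ => ENNReal.mul_ne_top (hutop m) (hqtop _)] at h'
    simp only [ENNReal.toReal_mul, ENNReal.toReal_one] at h'
    rw [← h']
    exact Finset.sum_congr rfl fun m hm => if_pos (by simpa using hm)
  have htan : Tendsto (fun N => ∑' m, (if m < N + 1 then u m * q (N - m) else 0)) atTop
      (nhds (∑' m, u m * escapeProb μ)) := by
    refine tendsto_tsum_of_dominated_convergence hus (fun m => ?_)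
      (Eventually.of_forall fun N m => ?_)
    · have h1 : Tendsto (fun N => u m * q (N - m)) atTop (nhds (u m * escapeProb μ)) :=
        (hlim.comp (tendsto_sub_atTop_nat m)).const_mul _
      refine h1.congr' ?_
      filter_upwards [eventually_ge_atTop m] with N hN
      rw [if_pos (by omega)]
    · have hu0 : 0 ≤ u m := ENNReal.toReal_nonneg
      split_ifs
      · rw [Real.norm_of_nonneg (mul_nonneg hu0 (hq0 _))]
        exact mul_le_of_le_one_right hu0 (hq1 _)
      · simpa using hu0
  simp only [hsum] at htan
  have h := tendsto_nhds_unique htan tendsto_const_nhds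
  rw [tsum_mul_right] at h
  rw [green, ENNReal.tsum_toReal_eq hutop, mul_comm]
  exact h

end Escape

section Decay

lemma exists_decay_bound {A B : ℝ} (hA : 1 ≤ A) :
    ∃ K : ℝ, ∀ a : ℕ → ℝ, (∀ n, 0 ≤ a n) → (∀ n, a n ≤ 1) → (∀ n, a (n + 1) ≤ a n) →
      (∀ n r : ℕ, 1 ≤ r → a n ≤ A * r ^ 2 * (a n - a (n + 1)) + B / r ^ 3) →
      ∀ n : ℕ, a n ≤ K / ((n + 1) * √(n + 1)) := by
  refine ⟨max (16 * A ^ 2) (128 * A ^ 2 * B), fun a ha0 ha1 hanti hnash n => ?_⟩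
  set K := max (16 * A ^ 2) (128 * A ^ 2 * B)
  have hK1 : 16 * A ^ 2 ≤ K := le_max_left _ _
  have hK2 : 128 * A ^ 2 * B ≤ K := le_max_right _ _
  have hK0 : 0 < K := by nlinarith
  induction n with
  | zero =>
    have : (1 : ℝ) ≤ K := by nlinarith
    simpa using (ha1 0).trans this
  | succ n ih =>
    have hn : (0 : ℝ) ≤ n := Nat.cast_nonneg n
    have hx1 : (((n + 1 : ℕ) : ℝ) + 1) = n + 2 := by push_cast; ring
    rw [hx1]
    set x : ℝ := n + 2 with hx
    have hxpos : 0 < x := by positivity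
    have hsx : 0 < √x := Real.sqrt_pos.2 hxpos
    have hsq : √x * √x = x := Real.mul_self_sqrt hxpos.le
    have hxx : 0 < x * √x := by positivity
    by_cases hsmall : x ≤ 4 * A
    · rw [le_div_iff₀ hxx]
      have h1 : √x ≤ x := by nlinarith
      calc a (n + 1) * (x * √x) ≤ 1 * (x * √x) := by
            gcongr; exact ha1 _
        _ ≤ x * x := by nlinarith
        _ ≤ K := by nlinarith
    by_cases hlow : a n ≤ K / (x * √x)
    · exact (hanti n).trans hlow
    push Not at hsmall hlow
    have hA0 : 0 < 4 * A := by linarith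
    obtain ⟨r, hr1, hr2, hr3⟩ : ∃ r : ℕ, 1 ≤ r ∧ 4 * A * (r : ℝ) ^ 2 ≤ x ∧
        x ≤ 16 * A * (r : ℝ) ^ 2 := by
      set y := x / (4 * A) with hy
      have hxy : x = 4 * A * y := by rw [hy]; field_simp
      have hy1 : 1 < y := (one_lt_div hA0).2 hsmall
      set r := Nat.sqrt ⌊y⌋₊
      have hf1 : 1 ≤ ⌊y⌋₊ := Nat.le_floor (by simpa using hy1.le)
      have hr1 : 1 ≤ r := Nat.le_sqrt.2 (by simpa using hf1)
      have hle : ((r * r : ℕ) : ℝ) ≤ y :=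
        (Nat.cast_le.2 (Nat.sqrt_le ⌊y⌋₊)).trans (Nat.floor_le (by linarith))
      have hlt : y < ((r + 1) * (r + 1) : ℕ) :=
        (Nat.lt_floor_add_one y).trans_le (by exact_mod_cast Nat.lt_succ_sqrt ⌊y⌋₊)
      have hr1' : (1 : ℝ) ≤ r := by exact_mod_cast hr1
      push_cast at hle hlt
      refine ⟨r, hr1, ?_, ?_⟩
      · rw [hxy]; nlinarith
      · rw [hxy]
        have : y ≤ 4 * (r : ℝ) ^ 2 := by nlinarith
        nlinarith
    have hr1' : (1 : ℝ) ≤ r := by exact_mod_cast hr1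
    have hsr : √x ≤ 4 * A * r := by
      rw [Real.sqrt_le_left (by positivity)]
      nlinarith [mul_nonneg (by linarith : (0 : ℝ) ≤ A - 1) (by positivity : (0 : ℝ) ≤ A * r ^ 2)]
    have hBr : B / (r : ℝ) ^ 3 ≤ a n / 2 := by
      have h1 : x * √x ≤ 64 * A ^ 2 * (r : ℝ) ^ 3 := by
        calc x * √x ≤ (16 * A * (r : ℝ) ^ 2) * (4 * A * r) := by gcongr
          _ = _ := by ring
      have h2 : K < a n * (x * √x) := (div_lt_iff₀ hxx).1 hlow
      rw [div_le_iff₀ (by positivity)]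
      have h3 : a n * (x * √x) ≤ a n * (64 * A ^ 2 * (r : ℝ) ^ 3) :=
        mul_le_mul_of_nonneg_left h1 (ha0 n)
      have h4 : 64 * A ^ 2 * (2 * B) ≤ 64 * A ^ 2 * (a n * (r : ℝ) ^ 3) := by linarith
      have h5 := le_of_mul_le_mul_left h4 (by positivity)
      linarith
    have hstep : x * a (n + 1) ≤ n * a n := by
      have h1 := hnash n r hr1
      have h2 : 4 * A * (r : ℝ) ^ 2 * (a n - a (n + 1)) ≤ x * (a n - a (n + 1)) :=
        mul_le_mul_of_nonneg_right hr2 (by linarith [hanti n])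
      have h3 : x = n + 2 := hx
      nlinarith
    have hs1 : 0 < √((n : ℝ) + 1) := Real.sqrt_pos.2 (by positivity)
    have hroot : n * √x ≤ (n + 1) * √((n : ℝ) + 1) := by
      refine (pow_le_pow_iff_left₀ (by positivity) (by positivity) two_ne_zero).1 ?_
      rw [mul_pow, mul_pow, Real.sq_sqrt hxpos.le, Real.sq_sqrt (by positivity), hx]
      nlinarith [mul_nonneg hn hn]
    rw [le_div_iff₀ (by positivity)] at ih
    rw [le_div_iff₀ hxx]
    calc a (n + 1) * (x * √x) = (x * a (n + 1)) * √x := by ring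
      _ ≤ (n * a n) * √x := by gcongr
      _ = a n * (n * √x) := by ring
      _ ≤ a n * ((n + 1) * √((n : ℝ) + 1)) := mul_le_mul_of_nonneg_left hroot (ha0 n)
      _ ≤ K := ih

lemma summable_inv_mul_sqrt (K : ℝ) :
    Summable fun n : ℕ => K / (((n : ℝ) + 1) * √((n : ℝ) + 1)) := by
  have h : Summable fun n : ℕ => 1 / (n : ℝ) ^ (3 / 2 : ℝ) :=
    Real.summable_one_div_nat_rpow.2 (by norm_num)
  have h' := ((summable_nat_add_iff 1).2 h).mul_left K
  refine h'.congr fun n => ?_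
  have hn : (0 : ℝ) < n + 1 := by positivity
  have : ((n + 1 : ℕ) : ℝ) ^ (3 / 2 : ℝ) = ((n : ℝ) + 1) * √((n : ℝ) + 1) := by
    push_cast
    rw [Real.sqrt_eq_rpow, ← Real.rpow_one_add' hn.le (by norm_num)]
    norm_num
  rw [this, mul_one_div]

lemma sq_tsum_add_le {ι : Type*} {p t : ι → ℝ} (hp0 : ∀ i, 0 ≤ p i) (hp : HasSum p 1)
    (h1 : Summable fun i => p i * t i) (h2 : Summable fun i => p i * t i ^ 2) {c : ℝ}
    (hc : 0 ≤ c) {i j : ι} (hi : c ≤ p i) (hj : c ≤ p j) :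
    (∑' k, p k * t k) ^ 2 + c / 2 * (t i - t j) ^ 2 ≤ ∑' k, p k * t k ^ 2 := by
  classical
  set m := ∑' k, p k * t k with hm
  have hvar : HasSum (fun k => p k * (t k - m) ^ 2)
      ((∑' k, p k * t k ^ 2) - 2 * m * m + m ^ 2 * 1) := by
    refine ((h2.hasSum.sub (h1.hasSum.mul_left (2 * m))).add (hp.mul_left (m ^ 2))).congr_fun ?_
    intro k
    ring
  rcases eq_or_ne i j with rfl | hij
  · have := hvar.nonneg fun k => mul_nonneg (hp0 k) (sq_nonneg _)
    nlinarith
  · have h := sum_le_hasSum {i, j} (fun k _ => mul_nonneg (hp0 k) (sq_nonneg (t k - m))) hvar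
    rw [Finset.sum_pair hij] at h
    have hi' := mul_le_mul_of_nonneg_right hi (sq_nonneg (t i - m))
    have hj' := mul_le_mul_of_nonneg_right hj (sq_nonneg (t j - m))
    have : c / 2 * (t i - t j) ^ 2 ≤ c * (t i - m) ^ 2 + c * (t j - m) ^ 2 := by
      nlinarith [mul_nonneg hc (sq_nonneg (t i - m + (t j - m)))]
    nlinarith

lemma IsProb.le_one {α : Type*} {f : α → ℝ} (hf : IsProb f) (x : α) : f x ≤ 1 :=
  le_hasSum hf.2 x fun y _ => hf.1 y

lemma IsProb.summable_sq {α : Type*} {f : α → ℝ} (hf : IsProb f) : Summable fun x => f x ^ 2 :=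
  hf.2.summable.of_nonneg_of_le (fun _ => sq_nonneg _) fun x => by
    nlinarith [hf.1 x, hf.le_one x]

lemma hasSum_mul_translate {p f : G → ℝ} (hp0 : ∀ g, 0 ≤ p g) (hp : HasSum p 1)
    (hf0 : ∀ g, 0 ≤ f g) {A : ℝ} (hf : HasSum f A) :
    HasSum (fun x => ∑' g, p g * f (x * g)) A := by
  have h : HasSum (fun z : G × G => p z.1 * f z.2) (1 * A) :=
    hp.mul hf (hp.summable.mul_of_nonneg hf.summable hp0 hf0)
  let e : G × G ≃ G × G :=
    { toFun := fun z => (z.2, z.1 * z.2)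
      invFun := fun z => (z.2 * z.1⁻¹, z.1)
      left_inv := fun z => by simp
      right_inv := fun z => by simp }
  have h' := e.hasSum_iff.2 h
  rw [one_mul] at h'
  exact h'.prod_fiberwise fun x => (h'.summable.prod_factor x).hasSum

/-- The energy of `f` in the direction of `y`. -/
noncomputable def energy (f : G → ℝ) (y : G) : ℝ := ∑' x, (f x - f (x * y)) ^ 2

lemma tsum_sq_translate (f : G → ℝ) (y : G) : ∑' x, f (x * y) ^ 2 = ∑' x, f x ^ 2 :=
  (Equiv.mulRight y).tsum_eq fun x => f x ^ 2

lemma IsProb.translate {f : G → ℝ} (hf : IsProb f) (y : G) : IsProb fun x => f (x * y) :=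
  ⟨fun _ => hf.1 _, (Equiv.mulRight y).hasSum_iff.2 hf.2⟩

lemma IsProb.summable_mul_translate {f : G → ℝ} (hf : IsProb f) (y : G) :
    Summable fun x => f x * f (x * y) :=
  hf.2.summable.of_nonneg_of_le (fun _ => mul_nonneg (hf.1 _) (hf.1 _)) fun x =>
    mul_le_of_le_one_right (hf.1 x) (hf.le_one _)

lemma IsProb.hasSum_energy {f : G → ℝ} (hf : IsProb f) (y : G) :
    HasSum (fun x => (f x - f (x * y)) ^ 2)
    (2 * ∑' x, f x ^ 2 - 2 * ∑' x, f x * f (x * y)) := by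
  have h := (hf.summable_sq.hasSum.add (hf.translate y).summable_sq.hasSum).sub
    ((hf.summable_mul_translate y).hasSum.mul_left 2)
  rw [tsum_sq_translate, ← two_mul] at h
  exact h.congr_fun fun x => by ring

lemma IsProb.tsum_sq_eq {f : G → ℝ} (hf : IsProb f) (y : G) :
    ∑' x, f x ^ 2 = energy f y / 2 + ∑' x, f x * f (x * y) := by
  rw [energy, (hf.hasSum_energy y).tsum_eq]
  ring

lemma IsProb.energy_mul_le {f : G → ℝ} (hf : IsProb f) (y z : G) {a : ℝ} (ha : 0 < a) :
    energy f (y * z) ≤ (1 + a) * energy f y + (1 + a⁻¹) * energy f z := by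
  have h1 : HasSum (fun x => (f x - f (x * y)) ^ 2) (energy f y) :=
    (hf.hasSum_energy y).summable.hasSum
  have h2 : HasSum (fun x => (f x - f (x * z)) ^ 2) (energy f z) :=
    (hf.hasSum_energy z).summable.hasSum
  have h3 : HasSum (fun x => (f (x * y) - f (x * y * z)) ^ 2) (energy f z) :=
    (Equiv.mulRight y).hasSum_iff (f := fun x => (f x - f (x * z)) ^ 2) |>.2 h2
  have h4 : HasSum (fun x => (f x - f (x * (y * z))) ^ 2) (energy f (y * z)) :=
    (hf.hasSum_energy (y * z)).summable.hasSum
  refine hasSum_le (fun x => ?_) h4 ((h1.mul_left (1 + a)).add (h3.mul_left (1 + a⁻¹)))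
  rw [← mul_assoc]
  generalize f x = u
  generalize f (x * y) = v
  generalize f (x * y * z) = w
  have h5 : a * (u - v) ^ 2 + a⁻¹ * (v - w) ^ 2 - 2 * (u - v) * (v - w)
      = a⁻¹ * (a * (u - v) - (v - w)) ^ 2 := by
    field_simp
    ring
  nlinarith [mul_nonneg (inv_pos.2 ha).le (sq_nonneg (a * (u - v) - (v - w)))]

lemma IsProb.energy_list_prod_le {f : G → ℝ} (hf : IsProb f) {T : Set G} {E : ℝ}
    (hE0 : 0 ≤ E) (hE : ∀ s ∈ T, energy f s ≤ E)
    (l : List G) (hl : ∀ s ∈ l, s ∈ insert 1 T) : energy f l.prod ≤ (l.length : ℝ) ^ 2 * E := by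
  have h1 : energy f 1 = 0 := by simp [energy]
  have hE' : ∀ s ∈ insert 1 T, energy f s ≤ E := by
    rintro s (rfl | hs)
    · rwa [h1]
    · exact hE s hs
  induction l with
  | nil => simp [h1]
  | cons s l ih =>
    have hs := hE' s (hl s (by simp))
    have ihl := ih fun t ht => hl t (by simp [ht])
    rcases Nat.eq_zero_or_pos l.length with h0 | h0
    · rw [List.eq_nil_of_length_eq_zero h0]
      simpa using hs
    · have hn : (0 : ℝ) < l.length := by exact_mod_cast h0
      rw [List.prod_cons, List.length_cons]
      calc energy f (s * l.prod)
          ≤ (1 + l.length) * energy f s + (1 + (l.length : ℝ)⁻¹) * energy f l.prod :=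
            hf.energy_mul_le _ _ hn
        _ ≤ (1 + l.length) * E + (1 + (l.length : ℝ)⁻¹) * ((l.length : ℝ) ^ 2 * E) := by gcongr
        _ = _ := by
          push_cast
          field_simp
          ring

/-- Nash inequality in terms of volume growth. -/
lemma IsProb.tsum_sq_le {f : G → ℝ} (hf : IsProb f) {T : Set G} {E : ℝ}
    (hE0 : 0 ≤ E) (hE : ∀ s ∈ T, energy f s ≤ E)
    {r : ℕ} {V : ℝ} (hV0 : 0 < V) (hV : V ≤ (ballOf T r).ncard) :
    ∑' x, f x ^ 2 ≤ (r : ℝ) ^ 2 * E / 2 + 1 / V := by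
  have hfin : (ballOf T r).Finite := by
    apply Set.finite_of_ncard_pos
    exact_mod_cast hV0.trans_le hV
  set F := hfin.toFinset with hF
  have hcard : V ≤ F.card := by rwa [Set.ncard_eq_toFinset_card _ hfin] at hV
  set a := ∑' x, f x ^ 2
  have hcorr : ∑ y ∈ F, ∑' x, f x * f (x * y) ≤ 1 := by
    rw [← Summable.tsum_finsetSum fun y _ => hf.summable_mul_translate y]
    refine hasSum_le (fun x => ?_)
      (summable_sum fun y _ => hf.summable_mul_translate y).hasSum hf.2
    rw [← Finset.mul_sum]
    refine mul_le_of_le_one_right (hf.1 x) ?_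
    exact sum_le_hasSum (f := fun y => f (x * y)) F (fun y _ => hf.1 _)
      ((Equiv.mulLeft x).hasSum_iff.2 hf.2)
  have hsum : F.card * a ≤ F.card * ((r : ℝ) ^ 2 * E / 2) + 1 := by
    calc F.card * a = ∑ y ∈ F, a := by simp
      _ = ∑ y ∈ F, (energy f y / 2 + ∑' x, f x * f (x * y)) :=
          Finset.sum_congr rfl fun y _ => hf.tsum_sq_eq y
      _ = ∑ y ∈ F, energy f y / 2 + ∑ y ∈ F, ∑' x, f x * f (x * y) := Finset.sum_add_distrib
      _ ≤ ∑ y ∈ F, (r : ℝ) ^ 2 * E / 2 + 1 := by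
          gcongr with y hy
          obtain ⟨l, rfl, hl, rfl⟩ := hfin.mem_toFinset.1 hy
          exact hf.energy_list_prod_le hE0 hE l hl
      _ = _ := by simp
  have hF0 : (0 : ℝ) < F.card := hV0.trans_le hcard
  calc a ≤ (r : ℝ) ^ 2 * E / 2 + 1 / F.card := by
        rw [← mul_le_mul_iff_right₀ hF0, mul_add, mul_one_div_cancel hF0.ne']
        exact hsum
    _ ≤ _ := by gcongr

lemma IsProb.tsum_sq_average_add_le {f : G → ℝ} (hf : IsProb f) {p : G → ℝ} (hp : IsProb p)
    {c : ℝ} (hc : 0 ≤ c) (h1 : c ≤ p 1) {s : G} (hs : c ≤ p s) :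
    ∑' x, (∑' g, p g * f (x * g)) ^ 2 + c / 2 * energy f s ≤ ∑' x, f x ^ 2 := by
  have hF : IsProb fun x => ∑' g, p g * f (x * g) :=
    ⟨fun x => tsum_nonneg fun g => mul_nonneg (hp.1 g) (hf.1 _),
      hasSum_mul_translate hp.1 hp.2 hf.1 hf.2⟩
  refine hasSum_le (fun x => ?_)
    (hF.summable_sq.hasSum.add ((hf.hasSum_energy s).summable.hasSum.mul_left (c / 2)))
    (hasSum_mul_translate hp.1 hp.2 (fun g => sq_nonneg (f g)) hf.summable_sq.hasSum)
  have h := sq_tsum_add_le (t := fun g => f (x * g)) hp.1 hp.2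
    (hp.2.summable.of_nonneg_of_le (fun g => mul_nonneg (hp.1 g) (hf.1 _))
      fun g => mul_le_of_le_one_right (hp.1 g) (hf.le_one _))
    (hp.2.summable.of_nonneg_of_le (fun g => mul_nonneg (hp.1 g) (sq_nonneg _))
      fun g => mul_le_of_le_one_right (hp.1 g) (pow_le_one₀ (hf.1 _) (hf.le_one _)))
    hc h1 hs
  simpa using h

end Decay

section Convergence

open scoped ENNReal

lemma isProb_toReal {α : Type*} {ν : α → ℝ≥0∞} (hν : ∑' x, ν x = 1) :
    IsProb fun x => (ν x).toReal := by
  refine ⟨fun x => ENNReal.toReal_nonneg, ?_⟩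
  have h := ENNReal.hasSum_toReal (hν.trans_ne ENNReal.one_ne_top)
  rwa [← ENNReal.tsum_toReal_eq fun x => ((hν ▸ ENNReal.le_tsum x : ν x ≤ 1).trans_lt
    ENNReal.one_lt_top).ne, hν, ENNReal.toReal_one] at h

lemma toReal_hitProb_succ {ν : G → ℝ≥0∞} (hν : ∑' g, ν g = 1) (n : ℕ) (x : G) :
    (hitProb ν (n + 1) x).toReal = ∑' g, (ν g).toReal * (hitProb ν n (x * g)).toReal := by
  rw [hitProb_succ, avg, ENNReal.tsum_toReal_eq]
  · simp only [ENNReal.toReal_mul]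
  · intro g
    refine ENNReal.mul_ne_top ?_ ((hitProb_le_one hν n _).trans_lt ENNReal.one_lt_top).ne
    exact ((hν ▸ ENNReal.le_tsum g : ν g ≤ 1).trans_lt ENNReal.one_lt_top).ne

lemma toReal_hitProb_add_le {ν : G → ℝ≥0∞} (hν : ∑' g, ν g = 1) (m n : ℕ) :
    (hitProb ν (m + n) 1).toReal ≤
      (∑' x, (hitProb ν m x).toReal ^ 2 + ∑' x, (hitProb ν n x).toReal ^ 2) / 2 := by
  have hm := isProb_toReal (tsum_hitProb_inv hν m)
  have hn := isProb_toReal (tsum_hitProb hν n)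
  have htop : ∀ k x, hitProb ν k x ≠ ⊤ := fun k x =>
    ((hitProb_le_one hν k x).trans_lt ENNReal.one_lt_top).ne
  rw [hitProb_add, ENNReal.tsum_toReal_eq fun y => ENNReal.mul_ne_top (htop _ _) (htop _ _)]
  simp only [ENNReal.toReal_mul, one_mul]
  have hinv : ∑' x, (hitProb ν m x).toReal ^ 2 = ∑' x, (hitProb ν m x⁻¹).toReal ^ 2 :=
    ((Equiv.inv G).tsum_eq fun x => (hitProb ν m x).toReal ^ 2).symm
  have hS := (hm.summable_sq.hasSum.add hn.summable_sq.hasSum).div_const 2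
  rw [hinv]
  have hle : ∀ y, (hitProb ν m y⁻¹).toReal * (hitProb ν n y).toReal ≤
      ((hitProb ν m y⁻¹).toReal ^ 2 + (hitProb ν n y).toReal ^ 2) / 2 := fun y => by
    nlinarith [sq_nonneg ((hitProb ν m y⁻¹).toReal - (hitProb ν n y).toReal)]
  refine hasSum_le hle (Summable.hasSum ?_) hS
  exact hS.summable.of_nonneg_of_le (fun y => mul_nonneg (hm.1 y) (hn.1 y)) hle

/-- Return probabilities of lazy walks charging a set of at least cubic growth have a summable
upper bound depending only on the set and on a lower bound for the charges. -/
lemma exists_summable_bound {T : Set G} {C c : ℝ} (hC : 0 < C) (hc : 0 < c)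
    (hT : ∀ n : ℕ, 1 ≤ n → C * (n : ℝ) ^ (3 : ℝ) ≤ ((ballOf T n).ncard : ℝ)) :
    ∃ b : ℕ → ℝ, Summable b ∧ ∀ ν : G → ℝ≥0∞, ∑' g, ν g = 1 → c ≤ (ν 1).toReal →
      (∀ s ∈ T, c ≤ (ν s).toReal) → ∀ n, (hitProb ν n 1).toReal ≤ b n := by
  obtain ⟨K, hK⟩ := exists_decay_bound (A := max 1 (1 / c)) (B := 1 / C) (le_max_left _ _)
  refine ⟨fun n => K / ((((n / 2 : ℕ) : ℝ) + 1) * √(((n / 2 : ℕ) : ℝ) + 1)), ?_, ?_⟩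
  · have h := summable_inv_mul_sqrt K
    refine (HasSum.even_add_odd (m := ∑' n : ℕ, K / (((n : ℝ) + 1) * √((n : ℝ) + 1)))
      (m' := ∑' n : ℕ, K / (((n : ℝ) + 1) * √((n : ℝ) + 1))) ?_ ?_).summable
    · refine h.hasSum.congr_fun fun n => ?_
      rw [show 2 * n / 2 = n by omega]
    · refine h.hasSum.congr_fun fun n => ?_
      rw [show (2 * n + 1) / 2 = n by omega]
  intro ν hν h1 hs
  set a : ℕ → ℝ := fun n => ∑' x, (hitProb ν n x).toReal ^ 2 with ha
  have hp := isProb_toReal hν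
  have hf : ∀ n, IsProb fun x => (hitProb ν n x).toReal := fun n =>
    isProb_toReal (tsum_hitProb hν n)
  have hstep : ∀ n s, c ≤ (ν s).toReal →
      a (n + 1) + c / 2 * energy (fun x => (hitProb ν n x).toReal) s ≤ a n := by
    intro n s hcs
    simp only [ha, toReal_hitProb_succ hν]
    exact (hf n).tsum_sq_average_add_le hp hc.le h1 hcs
  have hanti : ∀ n, a (n + 1) ≤ a n := fun n => by
    simpa [energy] using hstep n 1 h1
  have ha1 : ∀ n, a n ≤ 1 := fun n => by
    refine hasSum_le (fun x => ?_) (hf n).summable_sq.hasSum (hf n).2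
    nlinarith [(hf n).1 x, (hf n).le_one x]
  have hdecay := hK a (fun n => tsum_nonneg fun x => sq_nonneg _) ha1 hanti fun n r hr => by
    have hr0 : (0 : ℝ) < r := by exact_mod_cast hr
    have hdiff : 0 ≤ a n - a (n + 1) := by linarith [hanti n]
    have hTr := hT r hr
    rw [show (3 : ℝ) = (3 : ℕ) by norm_num, Real.rpow_natCast] at hTr
    calc a n ≤ (r : ℝ) ^ 2 * (2 / c * (a n - a (n + 1))) / 2 + 1 / (C * (r : ℝ) ^ 3) := by
          refine (hf n).tsum_sq_le (T := T) (by positivity) (fun s hsT => ?_) (by positivity) hTr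
          have := hstep n s (hs s hsT)
          rw [div_mul_eq_mul_div, le_div_iff₀ hc]
          linarith
      _ = 1 / c * (r : ℝ) ^ 2 * (a n - a (n + 1)) + 1 / C / (r : ℝ) ^ 3 := by
          field_simp
      _ ≤ _ := by
          gcongr
          exact le_max_right _ _
  have hle : ∀ n k, a (n + k) ≤ a n := fun n k => antitone_nat_of_succ_le hanti (by omega)
  intro n
  refine le_trans ?_ (hdecay (n / 2))
  have h := toReal_hitProb_add_le hν (n / 2) (n / 2 + n % 2)
  rw [show n / 2 + (n / 2 + n % 2) = n by omega] at h
  have := hle (n / 2) (n % 2)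
  simp only [ha] at this ⊢
  linarith

lemma tsum_le_liminf_tsum {ι : Type*} {f : ℕ → ι → ℝ≥0∞} {g : ι → ℝ≥0∞}
    (h : ∀ i, Tendsto (fun k => f k i) atTop (nhds (g i))) :
    ∑' i, g i ≤ liminf (fun k => ∑' i, f k i) atTop := by
  let _ : MeasurableSpace ι := ⊤
  simp only [← MeasureTheory.lintegral_count]
  simp only [← fun i => (h i).liminf_eq]
  exact MeasureTheory.lintegral_liminf_le fun k => measurable_from_top

/-- Expectations of bounded functions are continuous under pointwise convergence to a
probability measure. -/
lemma tendsto_tsum_mul {ι : Type*} {p f : ℕ → ι → ℝ≥0∞} {q g : ι → ℝ≥0∞}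
    (hp1 : ∀ k, ∑' i, p k i = 1) (hq1 : ∑' i, q i = 1) (hf1 : ∀ k i, f k i ≤ 1)
    (hp : ∀ i, Tendsto (fun k => p k i) atTop (nhds (q i)))
    (hf : ∀ i, Tendsto (fun k => f k i) atTop (nhds (g i))) :
    Tendsto (fun k => ∑' i, p k i * f k i) atTop (nhds (∑' i, q i * g i)) := by
  have hg1 : ∀ i, g i ≤ 1 := fun i => le_of_tendsto' (hf i) fun k => hf1 k i
  have hcompl : ∀ {p f : ι → ℝ≥0∞}, ∑' i, p i = 1 → (∀ i, f i ≤ 1) →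
      ∑' i, p i * f i = 1 - ∑' i, p i * (1 - f i) := by
    intro p f hp hf
    have h : ∑' i, p i * f i + ∑' i, p i * (1 - f i) = 1 := by
      rw [← ENNReal.tsum_add]
      refine Eq.trans (tsum_congr fun i => ?_) hp
      rw [← mul_add, add_tsub_cancel_of_le (hf i), mul_one]
    refine ENNReal.eq_sub_of_add_eq ?_ h
    exact ((le_add_self.trans h.le).trans_lt ENNReal.one_lt_top).ne
  have hmul : ∀ {f : ℕ → ι → ℝ≥0∞} {g : ι → ℝ≥0∞}, (∀ i, g i ≤ 1) →
      (∀ i, Tendsto (fun k => f k i) atTop (nhds (g i))) →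
      ∀ i, Tendsto (fun k => p k i * f k i) atTop (nhds (q i * g i)) := by
    intro f g hg1 hf i
    refine ENNReal.Tendsto.mul (hp i) (Or.inr ?_) (hf i) (Or.inr ?_)
    · exact ((hg1 i).trans_lt ENNReal.one_lt_top).ne
    · exact ((hq1 ▸ ENNReal.le_tsum i : q i ≤ 1).trans_lt ENNReal.one_lt_top).ne
  refine tendsto_of_le_liminf_of_limsup_le (tsum_le_liminf_tsum (hmul hg1 hf)) ?_
  have h := tsum_le_liminf_tsum (hmul (g := fun i => 1 - g i) (fun i => tsub_le_self)
    fun i => ENNReal.Tendsto.sub tendsto_const_nhds (hf i) (Or.inl ENNReal.one_ne_top))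
  rw [hcompl hq1 hg1]
  simp only [fun k => hcompl (hp1 k) (hf1 k)]
  rw [ENNReal.limsup_const_sub _ _ ENNReal.one_ne_top]
  exact tsub_le_tsub_left h 1

lemma tendsto_hitProb {p : ℕ → G → ℝ≥0∞} {q : G → ℝ≥0∞} (hp1 : ∀ k, ∑' g, p k g = 1)
    (hq1 : ∑' g, q g = 1) (hp : ∀ g, Tendsto (fun k => p k g) atTop (nhds (q g)))
    (n : ℕ) (x : G) : Tendsto (fun k => hitProb (p k) n x) atTop (nhds (hitProb q n x)) := by
  induction n generalizing x with
  | zero => exact tendsto_const_nhds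
  | succ n ih =>
    simp only [hitProb_succ]
    exact tendsto_tsum_mul hp1 hq1 (fun k g => hitProb_le_one (hp1 k) n _) hp fun g => ih (x * g)

lemma tendsto_geomStop {p : ℕ → G → ℝ≥0∞} {q : G → ℝ≥0∞} (hp1 : ∀ k, ∑' g, p k g = 1)
    (hq1 : ∑' g, q g = 1) (hp : ∀ g, Tendsto (fun k => p k g) atTop (nhds (q g))) (g : G) :
    Tendsto (fun k => geomStop (p k) g) atTop (nhds (geomStop q g)) :=
  tendsto_tsum_mul (fun _ => tsum_inv_two_pow_succ) tsum_inv_two_pow_succ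
    (fun k n => hitProb_le_one (hp1 k) n _) (fun _ => tendsto_const_nhds)
    fun n => tendsto_hitProb hp1 hq1 hp n g⁻¹

/-- The escape probability in terms of the walk observed at independent geometric times. -/
lemma escapeProb_mul_sub_one {μ : G → ℝ} (hμ : IsProb μ)
    (hs : Summable fun n =>
      (hitProb (geomStop fun g => ENNReal.ofReal (μ g)) n 1).toReal) :
    escapeProb μ *
      (∑' n, (hitProb (geomStop fun g => ENNReal.ofReal (μ g)) n 1).toReal - 1) = 1 := by
  set M : G → ℝ≥0∞ := fun g => ENNReal.ofReal (μ g) with hM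
  have hM1 : ∑' g, M g = 1 := tsum_ofReal_eq_one hμ
  have htop : ∀ n, hitProb (geomStop M) n 1 ≠ ⊤ := fun n =>
    ((hitProb_le_one (tsum_geomStop hM1) n 1).trans_lt ENNReal.one_lt_top).ne
  have hg : green (geomStop M) 1 ≠ ⊤ := by
    rw [green, ← tsum_congr fun n => ENNReal.ofReal_toReal (htop n),
      ← ENNReal.ofReal_tsum_of_nonneg (fun n => ENNReal.toReal_nonneg) hs]
    exact ENNReal.ofReal_ne_top
  have h1 : green (geomStop M) 1 = 1 + green M 1 := by
    rw [green_geomStop, Pi.add_apply, dirac, if_pos rfl]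
  have hg' : green M 1 ≠ ⊤ := fun h => hg (by rw [h1, h, add_top])
  have h2 : ∑' n, (hitProb (geomStop M) n 1).toReal - 1 = (green M 1).toReal := by
    rw [← ENNReal.tsum_toReal_eq htop, ← green, h1, ENNReal.toReal_add ENNReal.one_ne_top hg']
    simp
  rw [h2]
  exact escapeProb_mul_green hμ hg'

end Convergence

theorem escapeProb_continuity
    {G : Type*} [Group G] [Countable G]
    (μ : G → ℝ) (hμ : IsProb μ)
    (hgrowth : GrowthAtLeastWithin (suppSemigroup μ) 3)
    (μk : ℕ → G → ℝ) (hμk : ∀ k, IsProb (μk k))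
    (hpt : ∀ g : G, Tendsto (fun k => μk k g) atTop (nhds (μ g))) :
    Tendsto (fun k => escapeProb (μk k)) atTop (nhds (escapeProb μ)) := by
  obtain ⟨S, hS, -, C, hC, hgr⟩ := hgrowth
  set p : ℕ → G → ENNReal := fun k g => ENNReal.ofReal (μk k g) with hp
  set q : G → ENNReal := fun g => ENNReal.ofReal (μ g) with hq
  have hp1 : ∀ k, ∑' g, p k g = 1 := fun k => tsum_ofReal_eq_one (hμk k)
  have hq1 : ∑' g, q g = 1 := tsum_ofReal_eq_one hμ
  have hpq : ∀ g, Tendsto (fun k => p k g) atTop (nhds (q g)) := fun g =>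
    ENNReal.tendsto_ofReal (hpt g)
  have hν1 : ∀ k, ∑' g, geomStop (p k) g = 1 := fun k => tsum_geomStop (hp1 k)
  have hν1' : ∑' g, geomStop q g = 1 := tsum_geomStop hq1
  have hν := tendsto_geomStop hp1 hq1 hpq
  have htop : ∀ {ν : G → ENNReal}, ∑' g, ν g = 1 → ∀ g, ν g ≠ ⊤ := fun {ν} h g =>
    ((h ▸ ENNReal.le_tsum g : ν g ≤ 1).trans_lt ENNReal.one_lt_top).ne
  have hsupp : Function.support μ = Function.support q := by
    ext g
    simp [hq, (hμ.1 g).lt_iff_ne', not_le]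
  have hpos : ∀ s ∈ insert 1 (S : Set G), 0 < (geomStop q s).toReal := by
    intro s hs
    refine ENNReal.toReal_pos ?_ (htop hν1' s)
    rcases hs with rfl | hs
    · exact geomStop_one_ne_zero q
    · have hs' := hS hs
      rw [suppSemigroup, hsupp] at hs'
      obtain ⟨n, hn⟩ := exists_hitProb_ne_zero hs'
      exact geomStop_ne_zero hn
  have hfin : (insert 1 (S : Set G)).Finite := S.finite_toSet.insert 1
  obtain ⟨c, hc, hcs⟩ : ∃ c : ℝ, 0 < c ∧ ∀ s ∈ insert 1 (S : Set G), c < (geomStop q s).toReal := by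
    obtain ⟨s₀, hs₀, hmin⟩ := hfin.exists_minimalFor (fun s => (geomStop q s).toReal) _
      (Set.insert_nonempty _ _)
    refine ⟨(geomStop q s₀).toReal / 2, half_pos (hpos s₀ hs₀), fun s hs => ?_⟩
    have h1 : (geomStop q s₀).toReal ≤ (geomStop q s).toReal :=
      (le_total _ _).elim id fun h => hmin hs h
    linarith [hpos s₀ hs₀]
  obtain ⟨b, hb, hbound⟩ := exists_summable_bound hC hc hgr
  have hev : ∀ᶠ k in atTop, ∀ s ∈ insert 1 (S : Set G), c < (geomStop (p k) s).toReal := by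
    rw [hfin.eventually_all]
    intro s hs
    exact ((ENNReal.tendsto_toReal (htop hν1' s)).comp (hν s)).eventually_const_lt (hcs s hs)
  have hbq := hbound _ hν1' (hcs 1 (Set.mem_insert _ _)).le
    fun s hs => (hcs s (Set.mem_insert_of_mem _ hs)).le
  have hbp : ∀ᶠ k in atTop, ∀ n, (hitProb (geomStop (p k)) n 1).toReal ≤ b n :=
    hev.mono fun k hk => hbound _ (hν1 k) (hk 1 (Set.mem_insert _ _)).le
      fun s hs => (hk s (Set.mem_insert_of_mem _ hs)).le
  have hlim : Tendsto (fun k => ∑' n, (hitProb (geomStop (p k)) n 1).toReal) atTop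
      (nhds (∑' n, (hitProb (geomStop q) n 1).toReal)) := by
    refine tendsto_tsum_of_dominated_convergence hb (fun n => ?_) ?_
    · exact (ENNReal.tendsto_toReal (htop (tsum_hitProb hν1' n) 1)).comp
        (tendsto_hitProb hν1 hν1' hν n 1)
    · refine hbp.mono fun k hk n => ?_
      rw [Real.norm_of_nonneg ENNReal.toReal_nonneg]
      exact hk n
  have hsum : ∀ {ν : G → ENNReal}, (∀ n, (hitProb ν n 1).toReal ≤ b n) →
      Summable fun n => (hitProb ν n 1).toReal := fun h =>
    hb.of_nonneg_of_le (fun _ => ENNReal.toReal_nonneg) h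
  have hq_mul := escapeProb_mul_sub_one hμ (hsum hbq)
  rw [eq_inv_of_mul_eq_one_left hq_mul]
  refine ((hlim.sub_const 1).inv₀ (right_ne_zero_of_mul_eq_one hq_mul)).congr' ?_
  filter_upwards [hbp] with k hk
  exact (eq_inv_of_mul_eq_one_left (escapeProb_mul_sub_one (hμk k) (hsum hk))).symm

end RW
end

section
/- Let G be a countable group and let μ be a probability measure on G with H(μ) < ∞. Let {μ_k}_{k≥1} be probability measures on G such that μ_k(g) → μ(g) for all g ∈ G, H(μ_k) < ∞ for all k, and H(μ_k) → H(μ). Then for any n ≥ 1, H(μ_k^{*n}) → H(μ^{*n}) as k → ∞. -/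
open Filter

namespace RW


variable {G : Type*} [Group G]

/-- Generalized dominated convergence for series: the dominating functions may vary, as long as
their sums converge to the sum of their pointwise limit. -/
theorem tendsto_tsum_of_le_of_tendsto_tsum {α : Type*} {f F : ℕ → α → ℝ} {f' F' : α → ℝ}
    (h0 : ∀ k a, 0 ≤ f k a) (hle : ∀ k a, f k a ≤ F k a)
    (hF : ∀ k, Summable (F k)) (hF' : Summable F')
    (hf_lim : ∀ a, Tendsto (fun k => f k a) atTop (nhds (f' a)))
    (hF_lim : ∀ a, Tendsto (fun k => F k a) atTop (nhds (F' a)))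
    (hsum : Tendsto (fun k => ∑' a, F k a) atTop (nhds (∑' a, F' a))) :
    Tendsto (fun k => ∑' a, f k a) atTop (nhds (∑' a, f' a)) := by
  have hF0 : ∀ k a, 0 ≤ F k a := fun k a => (h0 k a).trans (hle k a)
  have hF'0 : ∀ a, 0 ≤ F' a := fun a => ge_of_tendsto' (hF_lim a) fun k => hF0 k a
  have hf'F' : ∀ a, f' a ≤ F' a := fun a =>
    le_of_tendsto_of_tendsto' (hf_lim a) (hF_lim a) fun k => hle k a
  have truncated : ∀ {u : ℕ → α → ℝ} {u' : α → ℝ}, (∀ k a, 0 ≤ u k a) → (∀ a, u' a ≤ F' a) →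
      (∀ a, Tendsto (fun k => u k a) atTop (nhds (u' a))) →
      Tendsto (fun k => ∑' a, min (u k a) (F' a)) atTop (nhds (∑' a, u' a)) := by
    intro u u' hu hu' hlim
    refine tendsto_tsum_of_dominated_convergence hF' (fun a => ?_) (.of_forall fun k a => ?_)
    · simpa [min_eq_left (hu' a)] using (hlim a).min (tendsto_const_nhds (x := F' a))
    · rw [Real.norm_of_nonneg (le_min (hu k a) (hF'0 a))]
      exact min_le_right _ _
  have hf : ∀ k, Summable (f k) := fun k => Summable.of_nonneg_of_le (h0 k) (hle k) (hF k)
  have hmin : ∀ {u : ℕ → α → ℝ}, (∀ k a, 0 ≤ u k a) → ∀ k,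
      Summable fun a => min (u k a) (F' a) := fun hu k =>
    Summable.of_nonneg_of_le (fun a => le_min (hu k a) (hF'0 a)) (fun a => min_le_right _ _) hF'
  have tf := truncated h0 hf'F' hf_lim
  have tF := truncated hF0 (fun a => le_rfl) hF_lim
  have upper := tf.add (hsum.sub tF)
  rw [sub_self, add_zero] at upper
  refine tendsto_of_tendsto_of_tendsto_of_le_of_le tf upper (fun k => ?_) (fun k => ?_)
  · exact (hmin h0 k).tsum_le_tsum (fun a => min_le_left _ _) (hf k)
  · change ∑' a, f k a ≤ _ + (_ - _)
    rw [← (hF k).tsum_sub (hmin hF0 k), ← (hmin h0 k).tsum_add ((hF k).sub (hmin hF0 k))]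
    refine (hf k).tsum_le_tsum (fun a => ?_) ((hmin h0 k).add ((hF k).sub (hmin hF0 k)))
    have := hle k a
    rcases le_total (f k a) (F' a) with h1 | h1 <;> rcases le_total (F k a) (F' a) with h2 | h2 <;>
      simp only [h1, h2, min_eq_left, min_eq_right] <;> linarith

/-- Pointwise convergence of nonnegative functions together with convergence of their sums implies
convergence of the sums along any injection. -/
theorem tendsto_tsum_comp_injective {α β : Type*} {F : ℕ → α → ℝ} {F' : α → ℝ}
    {e : β → α} (he : Function.Injective e)
    (h0 : ∀ k a, 0 ≤ F k a) (hF : ∀ k, Summable (F k)) (hF' : Summable F')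
    (hF_lim : ∀ a, Tendsto (fun k => F k a) atTop (nhds (F' a)))
    (hsum : Tendsto (fun k => ∑' a, F k a) atTop (nhds (∑' a, F' a))) :
    Tendsto (fun k => ∑' b, F k (e b)) atTop (nhds (∑' b, F' (e b))) := by
  have key : ∀ u : α → ℝ, ∑' b, u (e b) = ∑' a, (Set.range e).indicator u a := by
    intro u
    rw [← he.tsum_eq (f := (Set.range e).indicator u) Set.support_indicator_subset]
    simp
  simp only [key]
  refine tendsto_tsum_of_le_of_tendsto_tsum
    (fun k a => Set.indicator_nonneg (fun a _ => h0 k a) a)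
    (fun k a => Set.indicator_le_self' (fun a _ => h0 k a) a) hF hF' (fun a => ?_) hF_lim hsum
  by_cases ha : a ∈ Set.range e
  · simpa [Set.indicator_of_mem ha] using hF_lim a
  · simp [Set.indicator_of_notMem ha]

/-- Countable subadditivity of `x ↦ -x log x`. -/
theorem negMulLog_tsum_le {ι : Type*} {a : ι → ℝ} (h0 : ∀ i, 0 ≤ a i) (ha : Summable a)
    (hη : Summable fun i => Real.negMulLog (a i)) :
    Real.negMulLog (∑' i, a i) ≤ ∑' i, Real.negMulLog (a i) := by
  have h : Real.negMulLog (∑' i, a i) = ∑' i, a i * -Real.log (∑' j, a j) := by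
    rw [tsum_mul_right, Real.negMulLog]
    ring
  rw [h]
  refine (ha.mul_right _).tsum_le_tsum (fun i => ?_) hη
  rcases (h0 i).eq_or_lt with hi | hi
  · simp [← hi]
  · have := Real.log_le_log hi (ha.le_tsum i fun j _ => h0 j)
    rw [Real.negMulLog]
    nlinarith

theorem IsProb.le_one_s7 {G : Type*} {μ : G → ℝ} (hμ : IsProb μ) (g : G) : μ g ≤ 1 :=
  le_hasSum hμ.2 g fun j _ => hμ.1 j

theorem IsProb.negMulLog_nonneg {G : Type*} {μ : G → ℝ} (hμ : IsProb μ) (g : G) :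
    0 ≤ Real.negMulLog (μ g) :=
  Real.negMulLog_nonneg (hμ.1 g) (hμ.le_one_s7 g)

theorem IsProb.prod {G : Type*} {μ ν : G → ℝ} (hμ : IsProb μ) (hν : IsProb ν) :
    IsProb fun p : G × G => μ p.1 * ν p.2 := by
  refine ⟨fun p => mul_nonneg (hμ.1 _) (hν.1 _), ?_⟩
  have hs := hμ.2.summable.mul_of_nonneg hν.2.summable hμ.1 hν.1
  simpa using hμ.2.mul hν.2 hs

/-- The entropy of a product measure is the sum of the entropies. -/
theorem hasSum_negMulLog_prod {G : Type*} {μ ν : G → ℝ} (hμ : IsProb μ) (hν : IsProb ν)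
    (hHμ : FiniteEntropy μ) (hHν : FiniteEntropy ν) :
    HasSum (fun p : G × G => Real.negMulLog (μ p.1 * ν p.2)) (entropy μ + entropy ν) := by
  have s1 := hHμ.mul_of_nonneg hν.2.summable hμ.negMulLog_nonneg hν.1
  have s2 := hμ.2.summable.mul_of_nonneg hHν hμ.1 hν.negMulLog_nonneg
  have h := (hHμ.hasSum.mul hν.2 s1).add (hμ.2.mul hHν.hasSum s2)
  simp only [mul_one, one_mul] at h
  have key : (fun p : G × G => Real.negMulLog (μ p.1 * ν p.2)) =
      fun p => Real.negMulLog (μ p.1) * ν p.2 + μ p.1 * Real.negMulLog (ν p.2) := by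
    funext p
    rw [Real.negMulLog_mul]
    ring
  rw [key]
  exact h

/-- Reparametrization of `G × G` by the product of the coordinates and the second coordinate. -/
def divRightEquiv (G : Type*) [Group G] : G × G ≃ G × G where
  toFun p := (p.1 * p.2⁻¹, p.2)
  invFun p := (p.1 * p.2, p.2)
  left_inv p := by simp
  right_inv p := by simp

theorem fiber_injective {G : Type*} [Group G] (g : G) :
    Function.Injective fun h : G => (g * h⁻¹, h) := fun _ _ h => (Prod.ext_iff.1 h).2

theorem hasSum_fiber {G : Type*} [Group G] {u : G × G → ℝ} {s : ℝ} (hu : HasSum u s) :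
    HasSum (fun g => ∑' h : G, u (g * h⁻¹, h)) s := by
  have h := (divRightEquiv G).hasSum_iff.2 hu
  exact h.prod_fiberwise fun g => (hu.summable.comp_injective (fiber_injective g)).hasSum

theorem IsProb.conv {G : Type*} [Group G] {μ ν : G → ℝ} (hμ : IsProb μ) (hν : IsProb ν) :
    IsProb (conv μ ν) :=
  ⟨fun _ => tsum_nonneg fun _ => mul_nonneg (hμ.1 _) (hν.1 _), hasSum_fiber (hμ.prod hν).2⟩

theorem negMulLog_conv_le {G : Type*} [Group G] {μ ν : G → ℝ} (hμ : IsProb μ) (hν : IsProb ν)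
    (hHμ : FiniteEntropy μ) (hHν : FiniteEntropy ν) (g : G) :
    Real.negMulLog (conv μ ν g) ≤ ∑' h : G, Real.negMulLog (μ (g * h⁻¹) * ν h) := by
  have h1 := (hμ.prod hν).2.summable.comp_injective (fiber_injective g)
  have h2 := (hasSum_negMulLog_prod hμ hν hHμ hHν).summable.comp_injective (fiber_injective g)
  simp only [Function.comp_def] at h1 h2
  exact negMulLog_tsum_le (fun _ => mul_nonneg (hμ.1 _) (hν.1 _)) h1 h2

theorem FiniteEntropy.conv {G : Type*} [Group G] {μ ν : G → ℝ} (hμ : IsProb μ) (hν : IsProb ν)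
    (hHμ : FiniteEntropy μ) (hHν : FiniteEntropy ν) : FiniteEntropy (conv μ ν) :=
  Summable.of_nonneg_of_le (hμ.conv hν).negMulLog_nonneg (negMulLog_conv_le hμ hν hHμ hHν)
    (hasSum_fiber (hasSum_negMulLog_prod hμ hν hHμ hHν)).summable

section ConvergentSequences

variable {G : Type*} [Group G] {μ ν : G → ℝ} {μk νk : ℕ → G → ℝ}

theorem tendsto_conv (hμ : IsProb μ) (hν : IsProb ν)
    (hμk : ∀ k, IsProb (μk k)) (hνk : ∀ k, IsProb (νk k))
    (hμ_lim : ∀ g, Tendsto (fun k => μk k g) atTop (nhds (μ g)))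
    (hν_lim : ∀ g, Tendsto (fun k => νk k g) atTop (nhds (ν g))) (g : G) :
    Tendsto (fun k => conv (μk k) (νk k) g) atTop (nhds (conv μ ν g)) := by
  refine tendsto_tsum_comp_injective (e := fun h : G => (g * h⁻¹, h))
    (F := fun k p => μk k p.1 * νk k p.2) (F' := fun p => μ p.1 * ν p.2) (fiber_injective g) (fun k => ((hμk k).prod (hνk k)).1)
    (fun k => ((hμk k).prod (hνk k)).2.summable) (hμ.prod hν).2.summable
    (fun p => (hμ_lim p.1).mul (hν_lim p.2)) ?_
  simp only [fun k => ((hμk k).prod (hνk k)).2.tsum_eq, (hμ.prod hν).2.tsum_eq]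
  exact tendsto_const_nhds

/-- Entropy of convolutions is continuous along sequences of measures that converge pointwise
together with their entropies. -/
theorem tendsto_entropy_conv (hμ : IsProb μ) (hν : IsProb ν)
    (hμk : ∀ k, IsProb (μk k)) (hνk : ∀ k, IsProb (νk k))
    (hHμ : FiniteEntropy μ) (hHν : FiniteEntropy ν)
    (hHμk : ∀ k, FiniteEntropy (μk k)) (hHνk : ∀ k, FiniteEntropy (νk k))
    (hμ_lim : ∀ g, Tendsto (fun k => μk k g) atTop (nhds (μ g)))
    (hν_lim : ∀ g, Tendsto (fun k => νk k g) atTop (nhds (ν g)))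
    (hμ_ent : Tendsto (fun k => entropy (μk k)) atTop (nhds (entropy μ)))
    (hν_ent : Tendsto (fun k => entropy (νk k)) atTop (nhds (entropy ν))) :
    Tendsto (fun k => entropy (conv (μk k) (νk k))) atTop (nhds (entropy (conv μ ν))) := by
  have hsum := hasSum_negMulLog_prod hμ hν hHμ hHν
  have hsumk := fun k => hasSum_negMulLog_prod (hμk k) (hνk k) (hHμk k) (hHνk k)
  have hent := hμ_ent.add hν_ent
  refine tendsto_tsum_of_le_of_tendsto_tsum
    (F := fun k g => ∑' h : G, Real.negMulLog (μk k (g * h⁻¹) * νk k h))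
    (F' := fun g => ∑' h : G, Real.negMulLog (μ (g * h⁻¹) * ν h))
    (fun k => ((hμk k).conv (hνk k)).negMulLog_nonneg)
    (fun k => negMulLog_conv_le (hμk k) (hνk k) (hHμk k) (hHνk k))
    (fun k => (hasSum_fiber (hsumk k)).summable) (hasSum_fiber hsum).summable
    (fun g => (Real.continuous_negMulLog.tendsto _).comp
      (tendsto_conv hμ hν hμk hνk hμ_lim hν_lim g)) (fun g => ?_) ?_
  · refine tendsto_tsum_comp_injective (e := fun h : G => (g * h⁻¹, h))
      (F := fun k p => Real.negMulLog (μk k p.1 * νk k p.2))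
      (F' := fun p => Real.negMulLog (μ p.1 * ν p.2)) (fiber_injective g)
      (fun k => ((hμk k).prod (hνk k)).negMulLog_nonneg) (fun k => (hsumk k).summable)
      hsum.summable
      (fun p => (Real.continuous_negMulLog.tendsto _).comp ((hμ_lim p.1).mul (hν_lim p.2))) ?_
    simpa only [fun k => (hsumk k).tsum_eq, hsum.tsum_eq] using hent
  · simpa only [fun k => (hasSum_fiber (hsumk k)).tsum_eq, (hasSum_fiber hsum).tsum_eq] using hent

end ConvergentSequences

open Classical in
theorem isProb_convPow {G : Type*} [Group G] {μ : G → ℝ} (hμ : IsProb μ) :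
    ∀ n, IsProb (convPow μ n)
  | 0 => ⟨fun g => by simp only [convPow]; split_ifs <;> norm_num, hasSum_ite_eq 1 1⟩
  | n + 1 => (isProb_convPow hμ n).conv hμ

theorem finiteEntropy_convPow {G : Type*} [Group G] {μ : G → ℝ} (hμ : IsProb μ)
    (hH : FiniteEntropy μ) : ∀ n, FiniteEntropy (convPow μ n)
  | 0 => by
    have h : ∀ g : G, Real.negMulLog (convPow μ 0 g) = 0 := fun g => by
      simp only [convPow]; split_ifs <;> simp
    simp only [FiniteEntropy, h]
    exact summable_zero
  | n + 1 => FiniteEntropy.conv (isProb_convPow hμ n) hμ (finiteEntropy_convPow hμ hH n) hH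

theorem tendsto_convPow {G : Type*} [Group G] {μ : G → ℝ} {μk : ℕ → G → ℝ}
    (hμ : IsProb μ) (hμk : ∀ k, IsProb (μk k))
    (hpt : ∀ g, Tendsto (fun k => μk k g) atTop (nhds (μ g))) :
    ∀ n g, Tendsto (fun k => convPow (μk k) n g) atTop (nhds (convPow μ n g))
  | 0 => fun _ => tendsto_const_nhds
  | n + 1 => tendsto_conv (isProb_convPow hμ n) hμ (fun k => isProb_convPow (hμk k) n) hμk
      (tendsto_convPow hμ hμk hpt n) hpt

theorem convolution_entropy_convergence
    {G : Type*} [Group G] [Countable G]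
    (μ : G → ℝ) (hμ : IsProb μ) (hH : FiniteEntropy μ)
    (μk : ℕ → G → ℝ) (hμk : ∀ k, IsProb (μk k)) (hHk : ∀ k, FiniteEntropy (μk k))
    (hpt : ∀ g : G, Tendsto (fun k => μk k g) atTop (nhds (μ g)))
    (hent : Tendsto (fun k => entropy (μk k)) atTop (nhds (entropy μ))) :
    ∀ n : ℕ, 1 ≤ n →
      Tendsto (fun k => entropy (convPow (μk k) n)) atTop
        (nhds (entropy (convPow μ n))) := by
  intro n hn
  clear hn
  induction n with
  | zero => exact tendsto_const_nhds
  | succ n ih =>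
    exact tendsto_entropy_conv (isProb_convPow hμ n) hμ (fun k => isProb_convPow (hμk k) n) hμk
      (finiteEntropy_convPow hμ hH n) hH (fun k => finiteEntropy_convPow (hμk k) (hHk k) n) hHk
      (tendsto_convPow hμ hμk hpt n) hpt ih hent

end RW
end

section
/- Fix constants C₁ > 1, C₂ > 0 and d ≥ 1. There exists a constant C > 0, depending only on C₁, C₂ and d, with the following property: for every countable group G and all probability measures μ₁, μ₂ on G such that (1) μ₁ is symmetric (μ₁(g) = μ₁(g^{-1}) for all g), (2) μ₁(g) ≤ C₁ μ₂(g) for every g ∈ G, and (3) sup_{x,y∈G} p_{μ₁}^{(n)}(x,y) ≤ C₂ n^{-d/2} for all n ≥ 1, one has sup_{x,y∈G} p_{μ₂}^{(n)}(x,y) ≤ C n^{-d/2} for all n ≥ 1. -/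
open Filter

namespace RW


variable {G : Type*} [Group G]

open scoped ENNReal

section RealSequences

/-- A Nash-type inequality for convex sequences with polynomial decay. -/
lemma rpow_le_mul_sub_of_convex {B d : ℝ} (hB : 0 < B) (hd : 1 ≤ d) {a : ℕ → ℝ}
    (ha0 : 0 < a 0) (ha1 : a 0 ≤ 1) (hconv : ∀ k, 2 * a (k + 1) ≤ a k + a (k + 2))
    (hdecay : ∀ n : ℕ, 1 ≤ n → a n ≤ B * (n : ℝ) ^ (-(d / 2))) :
    a 0 ^ (1 + 2 / d) ≤ 2 * ((2 * B) ^ (2 / d) + 1) * (a 0 - a 1) := by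
  have hd0 : 0 < d := by linarith
  have hmono : ∀ k, a k - a (k + 1) ≤ a 0 - a 1 := by
    intro k
    induction k with
    | zero => simp
    | succ k ih => linarith [hconv k]
  have hlin : ∀ n : ℕ, a 0 ≤ a n + n * (a 0 - a 1) := by
    intro n
    induction n with
    | zero => simp
    | succ n ih => push_cast; linarith [hmono n]
  set t : ℝ := (2 * B / a 0) ^ (2 / d) with ht
  have ht0 : 0 < t := by positivity
  have hn1 : 1 ≤ ⌈t⌉₊ := Nat.one_le_ceil_iff.2 ht0
  have hnt : t ≤ (⌈t⌉₊ : ℝ) := Nat.le_ceil t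
  have hnt' : (⌈t⌉₊ : ℝ) < t + 1 := Nat.ceil_lt_add_one ht0.le
  have hhalf : a ⌈t⌉₊ ≤ a 0 / 2 := by
    refine (hdecay _ hn1).trans ?_
    have h1 : (⌈t⌉₊ : ℝ) ^ (-(d / 2)) ≤ t ^ (-(d / 2)) :=
      Real.rpow_le_rpow_of_nonpos ht0 hnt (by linarith)
    have h2 : t ^ (-(d / 2)) = (2 * B / a 0)⁻¹ := by
      rw [ht, ← Real.rpow_mul (by positivity), ← Real.rpow_neg_one]
      congr 1
      field_simp
    calc B * (⌈t⌉₊ : ℝ) ^ (-(d / 2)) ≤ B * (2 * B / a 0)⁻¹ := by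
          rw [← h2]; gcongr
      _ = a 0 / 2 := by field_simp
  set s : ℝ := a 0 ^ (2 / d) with hs
  have hs0 : 0 < s := by positivity
  have hs1 : s ≤ 1 := Real.rpow_le_one ha0.le ha1 (by positivity)
  have hst : s * t = (2 * B) ^ (2 / d) := by
    rw [hs, ht, ← Real.mul_rpow ha0.le (by positivity)]
    congr 1
    field_simp
  have hD : 0 ≤ a 0 - a 1 := by
    by_contra! h
    have : (⌈t⌉₊ : ℝ) * (a 0 - a 1) ≤ 0 :=
      mul_nonpos_of_nonneg_of_nonpos (by positivity) h.le
    linarith [hlin ⌈t⌉₊]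
  have hkey : a 0 ≤ 2 * ((t + 1) * (a 0 - a 1)) := by
    have : (⌈t⌉₊ : ℝ) * (a 0 - a 1) ≤ (t + 1) * (a 0 - a 1) := by gcongr
    linarith [hlin ⌈t⌉₊]
  rw [Real.rpow_add ha0, Real.rpow_one, ← hs]
  calc a 0 * s ≤ 2 * ((t + 1) * (a 0 - a 1)) * s := by gcongr
    _ = 2 * (s * t + s) * (a 0 - a 1) := by ring
    _ ≤ 2 * ((2 * B) ^ (2 / d) + 1) * (a 0 - a 1) := by rw [hst]; gcongr

/-- Polynomial decay from a discrete Nash-type differential inequality. -/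
lemma le_rpow_of_rpow_le_sub {c d : ℝ} (hc : 0 < c) (hd : 0 < d) {u : ℕ → ℝ}
    (hu : ∀ n, 0 < u n) (h : ∀ n, c * u n ^ (1 + 2 / d) ≤ u n - u (n + 1))
    {n : ℕ} (hn : 1 ≤ n) : u n ≤ (2 / d * c * n) ^ (-(d / 2)) := by
  have hp : 0 < 2 / d := by positivity
  have hstep : ∀ k, u k ^ (-(2 / d)) + 2 / d * c ≤ u (k + 1) ^ (-(2 / d)) := by
    intro k
    set x := c * u k ^ (2 / d) with hx
    have hle : u (k + 1) ≤ u k * (1 - x) := by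
      have := h k
      rw [Real.rpow_add (hu k), Real.rpow_one] at this
      rw [hx]; linarith
    have hexp : u (k + 1) ≤ u k * Real.exp (-x) := by
      refine hle.trans (mul_le_mul_of_nonneg_left ?_ (hu k).le)
      linarith [Real.add_one_le_exp (-x)]
    have h1 : (u k * Real.exp (-x)) ^ (-(2 / d)) ≤ u (k + 1) ^ (-(2 / d)) :=
      Real.rpow_le_rpow_of_nonpos (hu _) hexp (by linarith)
    refine le_trans ?_ h1
    rw [Real.mul_rpow (hu k).le (Real.exp_pos _).le, ← Real.exp_mul]
    have h2 : 1 + 2 / d * x ≤ Real.exp (-x * -(2 / d)) := by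
      have := Real.add_one_le_exp (-x * -(2 / d))
      linarith
    have hpos : 0 < u k ^ (-(2 / d)) := Real.rpow_pos_of_pos (hu k) _
    have h3 : u k ^ (-(2 / d)) * u k ^ (2 / d) = 1 := by
      rw [← Real.rpow_add (hu k)]; simp
    calc u k ^ (-(2 / d)) + 2 / d * c
        = u k ^ (-(2 / d)) + 2 / d * c * (u k ^ (-(2 / d)) * u k ^ (2 / d)) := by
          rw [h3, mul_one]
      _ = u k ^ (-(2 / d)) * (1 + 2 / d * x) := by rw [hx]; ring
      _ ≤ _ := by gcongr
  have hlin : ∀ k : ℕ, 2 / d * c * k ≤ u k ^ (-(2 / d)) := by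
    intro k
    induction k with
    | zero => simpa using (Real.rpow_pos_of_pos (hu 0) _).le
    | succ k ih => push_cast; linarith [hstep k]
  have hn0 : (0 : ℝ) < n := by exact_mod_cast hn
  have := Real.rpow_le_rpow_of_nonpos (z := -(d / 2)) (by positivity) (hlin n) (by linarith)
  rw [← Real.rpow_mul (hu n).le] at this
  have he : -(2 / d) * -(d / 2) = 1 := by field_simp
  rwa [he, Real.rpow_one] at this

end RealSequences

section ExtendedConvolution

lemma ennreal_two_mul_mul_le_sq_add_sq (a b : ℝ≥0∞) : 2 * (a * b) ≤ a ^ 2 + b ^ 2 := by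
  wlog hab : a ≤ b generalizing a b
  · rw [mul_comm a, add_comm]
    exact this b a (le_of_not_ge hab)
  obtain ⟨r, rfl⟩ := exists_add_of_le hab
  calc 2 * (a * (a + r)) ≤ 2 * (a * (a + r)) + r ^ 2 := le_self_add
    _ = a ^ 2 + (a + r) ^ 2 := by ring

/-- Convolution of functions with values in `[0, ∞]`. -/
noncomputable def econv (f m : G → ℝ≥0∞) : G → ℝ≥0∞ := fun g => ∑' h : G, f (g * h⁻¹) * m h

open Classical in
/-- Convolution powers of a function with values in `[0, ∞]`. -/
noncomputable def econvPow (m : G → ℝ≥0∞) : ℕ → G → ℝ≥0∞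
  | 0 => fun g => if g = 1 then 1 else 0
  | n + 1 => econv (econvPow m n) m

/-- The squared `ℓ²` norm of a function with values in `[0, ∞]`. -/
noncomputable def normSq (f : G → ℝ≥0∞) : ℝ≥0∞ := ∑' x, f x ^ 2

lemma tsum_mul_inv_right (f : G → ℝ≥0∞) (h : G) : ∑' x, f (x * h⁻¹) = ∑' x, f x :=
  (Equiv.mulRight h⁻¹).tsum_eq f

lemma tsum_mul_left_inv (f : G → ℝ≥0∞) (g : G) : ∑' x, f (g * x⁻¹) = ∑' x, f x :=
  ((Equiv.inv G).trans (Equiv.mulLeft g)).tsum_eq f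

lemma tsum_econv (f m : G → ℝ≥0∞) : ∑' x, econv f m x = (∑' x, f x) * ∑' x, m x := by
  unfold econv
  rw [ENNReal.tsum_comm]
  simp_rw [ENNReal.tsum_mul_right, tsum_mul_inv_right, ENNReal.tsum_mul_left]

lemma econv_assoc (f m k : G → ℝ≥0∞) : econv (econv f m) k = econv f (econv m k) := by
  funext g
  unfold econv
  simp_rw [← ENNReal.tsum_mul_right, ← ENNReal.tsum_mul_left]
  rw [ENNReal.tsum_comm (f := fun h i => f (g * h⁻¹) * (m (h * i⁻¹) * k i))]
  refine tsum_congr fun i => ?_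
  rw [← tsum_mul_inv_right (fun j => f (g * i⁻¹ * j⁻¹) * m j * k i) i]
  refine tsum_congr fun h => ?_
  simp only [mul_inv_rev, inv_inv, mul_assoc, inv_mul_cancel_left]

lemma econv_econvPow_zero (f m : G → ℝ≥0∞) : econv f (econvPow m 0) = f := by
  funext g
  unfold econv
  rw [tsum_eq_single 1 (fun h hh => by simp [econvPow, hh])]
  simp [econvPow]

lemma econv_econvPow_succ (f m : G → ℝ≥0∞) (n : ℕ) :
    econv f (econvPow m (n + 1)) = econv (econv f (econvPow m n)) m := by
  rw [econv_assoc]; rfl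

lemma econvPow_add (m : G → ℝ≥0∞) (k n : ℕ) :
    econvPow m (k + n) = econv (econvPow m k) (econvPow m n) := by
  induction n with
  | zero => rw [econv_econvPow_zero, add_zero]
  | succ n ih => rw [econv_econvPow_succ, ← ih]; rfl

lemma econv_self_econvPow (m : G → ℝ≥0∞) (n : ℕ) :
    econv m (econvPow m n) = econvPow m (n + 1) := by
  induction n with
  | zero =>
    rw [econv_econvPow_zero]
    funext g
    change m g = ∑' h, econvPow m 0 (g * h⁻¹) * m h
    rw [tsum_eq_single g (fun h hh => ?_)]
    · simp [econvPow]
    · have : g * h⁻¹ ≠ 1 := fun e => hh (mul_inv_eq_one.1 e).symm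
      simp [econvPow, this]
  | succ n ih => rw [econv_econvPow_succ, ih]; rfl

lemma tsum_econvPow {m : G → ℝ≥0∞} (hm : ∑' x, m x = 1) (n : ℕ) :
    ∑' x, econvPow m n x = 1 := by
  induction n with
  | zero => simp [econvPow]
  | succ n ih => rw [econvPow, tsum_econv, ih, hm, one_mul]

lemma econvPow_le_one {m : G → ℝ≥0∞} (hm : ∑' x, m x = 1) (n : ℕ) (x : G) :
    econvPow m n x ≤ 1 :=
  (ENNReal.le_tsum x).trans (tsum_econvPow hm n).le

lemma econv_le_of_le_left {f m : G → ℝ≥0∞} {b : ℝ≥0∞} (hf : ∀ x, f x ≤ b) (g : G) :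
    econv f m g ≤ b * ∑' x, m x := by
  rw [← ENNReal.tsum_mul_left]
  exact ENNReal.tsum_le_tsum fun h => mul_le_mul_left (hf _) _

lemma econv_le_of_le_right {f m : G → ℝ≥0∞} {b : ℝ≥0∞} (hm : ∀ x, m x ≤ b) (g : G) :
    econv f m g ≤ (∑' x, f x) * b := by
  rw [← tsum_mul_left_inv f g, ← ENNReal.tsum_mul_right]
  exact ENNReal.tsum_le_tsum fun h => mul_le_mul_right (hm _) _

lemma econv_self_le_normSq (f : G → ℝ≥0∞) (g : G) : econv f f g ≤ normSq f := by
  have h : 2 * econv f f g ≤ 2 * normSq f := by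
    calc 2 * econv f f g = ∑' h, 2 * (f (g * h⁻¹) * f h) := by
          rw [ENNReal.tsum_mul_left]; rfl
      _ ≤ ∑' h, (f (g * h⁻¹) ^ 2 + f h ^ 2) :=
          ENNReal.tsum_le_tsum fun h => ennreal_two_mul_mul_le_sq_add_sq _ _
      _ = 2 * normSq f := by
          rw [ENNReal.tsum_add, tsum_mul_left_inv (fun x => f x ^ 2), two_mul]; rfl
  exact (ENNReal.mul_le_mul_iff_right two_ne_zero ENNReal.ofNat_ne_top).1 h

lemma normSq_le_one {α : Type*} {f : α → ℝ≥0∞} (hf : ∑' x, f x = 1) : normSq f ≤ 1 := by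
  rw [← hf]
  refine ENNReal.tsum_le_tsum fun x => ?_
  rw [sq]
  exact mul_le_of_le_one_left' ((ENNReal.le_tsum x).trans hf.le)

lemma normSq_ne_zero {α : Type*} {f : α → ℝ≥0∞} (hf : ∑' x, f x = 1) : normSq f ≠ 0 := by
  intro h
  have : ∀ x, f x = 0 := fun x => by simpa using ENNReal.tsum_eq_zero.1 h x
  simp [this] at hf

lemma tsum_econv_mul_comm {m : G → ℝ≥0∞} (hm : ∀ g, m g = m g⁻¹) (f k : G → ℝ≥0∞) :
    ∑' x, econv f m x * k x = ∑' x, f x * econv k m x := by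
  unfold econv
  simp_rw [← ENNReal.tsum_mul_right, ← ENNReal.tsum_mul_left]
  rw [ENNReal.tsum_comm, ENNReal.tsum_comm (f := fun x h => f x * (k (x * h⁻¹) * m h)),
    ← (Equiv.inv G).tsum_eq]
  refine tsum_congr fun h => ?_
  rw [← tsum_mul_inv_right _ h]
  refine tsum_congr fun x => ?_
  simp only [Equiv.inv_apply, inv_inv, inv_mul_cancel_right, ← hm h]
  ring

lemma normSq_econv_convex {m : G → ℝ≥0∞} (hm : ∀ g, m g = m g⁻¹) (f : G → ℝ≥0∞) :
    2 * normSq (econv f m) ≤ normSq f + normSq (econv (econv f m) m) := by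
  have h : normSq (econv f m) = ∑' x, f x * econv (econv f m) m x := by
    rw [← tsum_econv_mul_comm hm]
    simp only [normSq, sq]
  rw [h, ← ENNReal.tsum_mul_left, normSq, normSq, ← ENNReal.tsum_add]
  exact ENNReal.tsum_le_tsum fun x => ennreal_two_mul_mul_le_sq_add_sq _ _

lemma tsum_econv_econvPow_mul_comm {m : G → ℝ≥0∞} (hm : ∀ g, m g = m g⁻¹)
    (f k : G → ℝ≥0∞) (n : ℕ) :
    ∑' x, econv f (econvPow m n) x * k x = ∑' x, f x * econv k (econvPow m n) x := by
  induction n generalizing f k with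
  | zero => simp_rw [econv_econvPow_zero]
  | succ n ih =>
    rw [econv_econvPow_succ, tsum_econv_mul_comm hm, ih, econv_assoc, econv_self_econvPow]

lemma normSq_econv_econvPow_le {m f : G → ℝ≥0∞} (hm : ∀ g, m g = m g⁻¹)
    (hf : ∑' x, f x = 1) {n : ℕ} {b : ℝ≥0∞} (hb : ∀ x, econvPow m (n + n) x ≤ b) :
    normSq (econv f (econvPow m n)) ≤ b := by
  calc normSq (econv f (econvPow m n))
      = ∑' x, f x * econv f (econvPow m (n + n)) x := by
        rw [econvPow_add, ← econv_assoc, ← tsum_econv_econvPow_mul_comm hm]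
        simp only [normSq, sq]
    _ ≤ ∑' x, f x * ((∑' y, f y) * b) :=
        ENNReal.tsum_le_tsum fun x => mul_le_mul_right (econv_le_of_le_right hb x) _
    _ = b := by rw [ENNReal.tsum_mul_right, hf, one_mul, one_mul]

lemma normSq_econv_eq (f m : G → ℝ≥0∞) :
    normSq (econv f m) = ∑' x, ∑' g, ∑' h, m g * m h * (f (x * g⁻¹) * f (x * h⁻¹)) := by
  refine tsum_congr fun x => ?_
  rw [sq]
  unfold econv
  rw [← ENNReal.tsum_mul_right]
  refine tsum_congr fun g => ?_
  rw [← ENNReal.tsum_mul_left]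
  exact tsum_congr fun h => by ring

lemma two_mul_normSq_eq {m : G → ℝ≥0∞} (hm : ∑' x, m x = 1) (f : G → ℝ≥0∞) :
    2 * normSq f =
      ∑' x, ∑' g, ∑' h, m g * m h * (f (x * g⁻¹) ^ 2 + f (x * h⁻¹) ^ 2) := by
  have h1 : ∑' x, ∑' g, m g * f (x * g⁻¹) ^ 2 = normSq f := by
    rw [ENNReal.tsum_comm]
    simp_rw [ENNReal.tsum_mul_left, fun g => tsum_mul_inv_right (fun x => f x ^ 2) g,
      ENNReal.tsum_mul_right, hm, one_mul]
    rfl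
  simp_rw [mul_add, ENNReal.tsum_add, mul_assoc, ENNReal.tsum_mul_left,
    ENNReal.tsum_mul_right, hm, one_mul]
  have h2 : ∀ x g, ∑' h, m h * f (x * g⁻¹) ^ 2 = f (x * g⁻¹) ^ 2 := fun x g => by
    rw [ENNReal.tsum_mul_right, hm, one_mul]
  simp_rw [h1, two_mul]

/-- Comparison of the Dirichlet forms `‖f‖² - ‖f * mᵢ‖²` for `m₁ ≤ c m₂`. -/
lemma normSq_comparison {m₁ m₂ : G → ℝ≥0∞} {c : ℝ≥0∞} (h₁ : ∑' x, m₁ x = 1)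
    (h₂ : ∑' x, m₂ x = 1) (hle : ∀ g, m₁ g ≤ c * m₂ g) (f : G → ℝ≥0∞) :
    normSq f + c ^ 2 * normSq (econv f m₂) ≤ c ^ 2 * normSq f + normSq (econv f m₁) := by
  have key : 2 * normSq f + c ^ 2 * (2 * normSq (econv f m₂)) ≤
      c ^ 2 * (2 * normSq f) + 2 * normSq (econv f m₁) := by
    nth_rewrite 1 [two_mul_normSq_eq h₁ f]
    rw [two_mul_normSq_eq h₂ f, normSq_econv_eq, normSq_econv_eq]
    simp_rw [← ENNReal.tsum_mul_left, ← ENNReal.tsum_add]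
    refine ENNReal.tsum_le_tsum fun x => ENNReal.tsum_le_tsum fun g =>
      ENNReal.tsum_le_tsum fun h => ?_
    obtain ⟨r, hr⟩ := exists_add_of_le (mul_le_mul' (hle g) (hle h))
    set a := f (x * g⁻¹)
    set b := f (x * h⁻¹)
    calc m₁ g * m₁ h * (a ^ 2 + b ^ 2) + c ^ 2 * (2 * (m₂ g * m₂ h * (a * b)))
        = m₁ g * m₁ h * (a ^ 2 + b ^ 2) + c * m₂ g * (c * m₂ h) * (2 * (a * b)) := by ring
      _ = m₁ g * m₁ h * (a ^ 2 + b ^ 2) + m₁ g * m₁ h * (2 * (a * b)) +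
          r * (2 * (a * b)) := by rw [hr]; ring
      _ ≤ m₁ g * m₁ h * (a ^ 2 + b ^ 2) + m₁ g * m₁ h * (2 * (a * b)) +
          r * (a ^ 2 + b ^ 2) := by
        gcongr
        exact ennreal_two_mul_mul_le_sq_add_sq a b
      _ = c * m₂ g * (c * m₂ h) * (a ^ 2 + b ^ 2) + m₁ g * m₁ h * (2 * (a * b)) := by
        rw [hr]; ring
      _ = c ^ 2 * (m₂ g * m₂ h * (a ^ 2 + b ^ 2)) + 2 * (m₁ g * m₁ h * (a * b)) := by ring
  refine (ENNReal.mul_le_mul_iff_right two_ne_zero ENNReal.ofNat_ne_top).1 ?_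
  calc _ = 2 * normSq f + c ^ 2 * (2 * normSq (econv f m₂)) := by ring
    _ ≤ _ := key
    _ = _ := by ring

end ExtendedConvolution

section Transfer

lemma IsProb.tsum_ofReal {α : Type*} {μ : α → ℝ} (hμ : IsProb μ) : ∑' x, ENNReal.ofReal (μ x) = 1 := by
  rw [← ENNReal.ofReal_tsum_of_nonneg hμ.1 hμ.2.summable, hμ.2.tsum_eq, ENNReal.ofReal_one]

lemma IsProb.convPow_eq {μ : G → ℝ} (hμ : IsProb μ) (n : ℕ) (g : G) :
    convPow μ n g = (econvPow (fun x => ENNReal.ofReal (μ x)) n g).toReal := by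
  have hfin : ∀ n x, econvPow (fun x => ENNReal.ofReal (μ x)) n x ≠ ∞ := fun n x =>
    ((econvPow_le_one hμ.tsum_ofReal n x).trans_lt ENNReal.one_lt_top).ne
  induction n generalizing g with
  | zero => by_cases h : g = 1 <;> simp [convPow, econvPow, h]
  | succ n ih =>
    simp only [convPow, conv, econvPow, econv]
    rw [ENNReal.tsum_toReal_eq fun h => ENNReal.mul_ne_top (hfin n _) ENNReal.ofReal_ne_top]
    refine tsum_congr fun h => ?_
    rw [ih, ENNReal.toReal_mul, ENNReal.toReal_ofReal (hμ.1 h)]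

/-- Nash inequality for convolution by `m₂`, when `m₂` dominates a symmetric `m₁` whose
convolution powers decay polynomially. -/
lemma normSq_rpow_le {C₁ B d : ℝ} (hC₁ : 1 < C₁) (hB : 0 < B) (hd : 1 ≤ d)
    {m₁ m₂ : G → ℝ≥0∞} (h₁ : ∑' x, m₁ x = 1) (h₂ : ∑' x, m₂ x = 1)
    (hsymm : ∀ g, m₁ g = m₁ g⁻¹) (hle : ∀ g, m₁ g ≤ ENNReal.ofReal C₁ * m₂ g)
    (hdecay : ∀ n : ℕ, 1 ≤ n → ∀ g,
      econvPow m₁ n g ≤ ENNReal.ofReal (B * (n : ℝ) ^ (-(d / 2))))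
    {f : G → ℝ≥0∞} (hf : ∑' x, f x = 1) :
    (normSq f).toReal ^ (1 + 2 / d) ≤ 2 * ((2 * B) ^ (2 / d) + 1) * C₁ ^ 2 *
      ((normSq f).toReal - (normSq (econv f m₂)).toReal) := by
  have hC0 : 0 < C₁ := by linarith
  have hfin : ∀ {k : G → ℝ≥0∞}, ∑' x, k x = 1 → normSq k ≠ ∞ := fun hk =>
    ((normSq_le_one hk).trans_lt ENNReal.one_lt_top).ne
  have hmass : ∀ n, ∑' x, econv f (econvPow m₁ n) x = 1 := fun n => by
    rw [tsum_econv, hf, tsum_econvPow h₁, one_mul]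
  have hmass₁ : ∑' x, econv f m₁ x = 1 := by rw [tsum_econv, hf, h₁, one_mul]
  have hmass₂ : ∑' x, econv f m₂ x = 1 := by rw [tsum_econv, hf, h₂, one_mul]
  set a : ℕ → ℝ := fun n => (normSq (econv f (econvPow m₁ n))).toReal with ha
  have ha0 : a 0 = (normSq f).toReal := by simp only [ha, econv_econvPow_zero]
  have ha1 : a 1 = (normSq (econv f m₁)).toReal := by
    simp only [ha, econv_econvPow_succ f m₁ 0, econv_econvPow_zero]
  have hnash : a 0 ^ (1 + 2 / d) ≤ 2 * ((2 * B) ^ (2 / d) + 1) * (a 0 - a 1) := by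
    apply rpow_le_mul_sub_of_convex hB hd
    · rw [ha0]
      exact ENNReal.toReal_pos (normSq_ne_zero hf) (hfin hf)
    · rw [ha0]
      exact ENNReal.toReal_le_of_le_ofReal zero_le_one (by simpa using normSq_le_one hf)
    · intro k
      have h := normSq_econv_convex hsymm (econv f (econvPow m₁ k))
      rw [← econv_econvPow_succ, ← econv_econvPow_succ] at h
      have h' := ENNReal.toReal_mono
        (ENNReal.add_ne_top.2 ⟨hfin (hmass k), hfin (hmass (k + 2))⟩) h
      rwa [ENNReal.toReal_mul, ENNReal.toReal_add (hfin (hmass k)) (hfin (hmass (k + 2)))] at h'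
    · intro n hn
      have hn0 : (0 : ℝ) < n := by exact_mod_cast hn
      refine ENNReal.toReal_le_of_le_ofReal (by positivity)
        (normSq_econv_econvPow_le hsymm hf fun x => ?_)
      refine (hdecay (n + n) (by omega) x).trans (ENNReal.ofReal_le_ofReal ?_)
      gcongr B * ?_
      refine Real.rpow_le_rpow_of_nonpos hn0 ?_ (by linarith)
      push_cast
      linarith
  have hcomp : a 0 - a 1 ≤
      C₁ ^ 2 * ((normSq f).toReal - (normSq (econv f m₂)).toReal) := by
    have hc : ENNReal.ofReal C₁ ^ 2 ≠ ∞ := ENNReal.pow_ne_top ENNReal.ofReal_ne_top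
    have h := ENNReal.toReal_mono (ENNReal.add_ne_top.2
      ⟨ENNReal.mul_ne_top hc (hfin hf), hfin hmass₁⟩) (normSq_comparison h₁ h₂ hle f)
    rw [ENNReal.toReal_add (hfin hf) (ENNReal.mul_ne_top hc (hfin hmass₂)),
      ENNReal.toReal_add (ENNReal.mul_ne_top hc (hfin hf)) (hfin hmass₁),
      ENNReal.toReal_mul, ENNReal.toReal_mul, ENNReal.toReal_pow,
      ENNReal.toReal_ofReal hC0.le] at h
    rw [ha0, ha1]
    linarith
  rw [← ha0, mul_assoc]
  refine hnash.trans ?_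
  rw [← ha0] at hcomp
  gcongr

end Transfer

theorem coulhon_saloffCoste_uniform_comparison
    (C₁ C₂ d : ℝ) (hC₁ : 1 < C₁) (hC₂ : 0 < C₂) (hd : 1 ≤ d) :
    ∃ C : ℝ, 0 < C ∧
      ∀ (G : Type*) [Group G] [Countable G], ∀ μ₁ μ₂ : G → ℝ,
        IsProb μ₁ → IsProb μ₂ →
        (∀ g : G, μ₁ g = μ₁ g⁻¹) →
        (∀ g : G, μ₁ g ≤ C₁ * μ₂ g) →
        (∀ n : ℕ, 1 ≤ n → ∀ x y : G, convPow μ₁ n (x⁻¹ * y) ≤ C₂ * (n : ℝ) ^ (-(d / 2))) →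
        ∀ n : ℕ, 1 ≤ n → ∀ x y : G, convPow μ₂ n (x⁻¹ * y) ≤ C * (n : ℝ) ^ (-(d / 2)) := by
  have hd0 : 0 < d := by linarith
  have hC0 : 0 < C₁ := by linarith
  set K : ℝ := 2 * ((2 * C₂) ^ (2 / d) + 1) * C₁ ^ 2 with hK
  have hK0 : 0 < K := by positivity
  set κ : ℝ := 2 / d * K⁻¹ with hκ
  have hκ0 : 0 < κ := by positivity
  refine ⟨1 + (κ / 3) ^ (-(d / 2)), by positivity, ?_⟩
  intro G _ _ μ₁ μ₂ hμ₁ hμ₂ hsymm hle hdecay n hn x y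
  set m₁ : G → ℝ≥0∞ := fun x => ENNReal.ofReal (μ₁ x) with hm₁
  set m₂ : G → ℝ≥0∞ := fun x => ENNReal.ofReal (μ₂ x) with hm₂
  have h₁ : ∑' x, m₁ x = 1 := hμ₁.tsum_ofReal
  have h₂ : ∑' x, m₂ x = 1 := hμ₂.tsum_ofReal
  have hdecay' : ∀ n : ℕ, 1 ≤ n → ∀ g,
      econvPow m₁ n g ≤ ENNReal.ofReal (C₂ * (n : ℝ) ^ (-(d / 2))) := by
    intro n hn g
    have h := hdecay n hn 1 g
    rw [hμ₁.convPow_eq, inv_one, one_mul] at h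
    rw [← ENNReal.ofReal_toReal
      ((econvPow_le_one h₁ n g).trans_lt ENNReal.one_lt_top).ne]
    exact ENNReal.ofReal_le_ofReal h
  have hfin : ∀ k, normSq (econvPow m₂ k) ≠ ∞ := fun k =>
    ((normSq_le_one (tsum_econvPow h₂ k)).trans_lt ENNReal.one_lt_top).ne
  have hnorm : ∀ k : ℕ, 1 ≤ k →
      (normSq (econvPow m₂ k)).toReal ≤ (κ * k) ^ (-(d / 2)) := by
    intro k hk
    refine le_rpow_of_rpow_le_sub (u := fun k => (normSq (econvPow m₂ k)).toReal)
      (inv_pos.2 hK0) hd0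
      (fun j => ENNReal.toReal_pos (normSq_ne_zero (tsum_econvPow h₂ j)) (hfin j))
      (fun j => ?_) hk
    rw [inv_mul_le_iff₀ hK0]
    refine normSq_rpow_le hC₁ hC₂ hd h₁ h₂ (fun g => ?_) (fun g => ?_) hdecay'
      (tsum_econvPow h₂ j)
    · simp only [hm₁, hsymm g]
    · simp only [hm₁, hm₂]
      rw [← ENNReal.ofReal_mul hC0.le]
      exact ENNReal.ofReal_le_ofReal (hle g)
  have hn0 : (0 : ℝ) < n := by exact_mod_cast hn
  rw [hμ₂.convPow_eq]
  rcases hn.eq_or_lt with rfl | hn2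
  · have h : (econvPow m₂ 1 (x⁻¹ * y)).toReal ≤ 1 :=
      ENNReal.toReal_le_of_le_ofReal zero_le_one (by simpa using econvPow_le_one h₂ 1 _)
    have : 0 < (κ / 3) ^ (-(d / 2)) := by positivity
    simpa using h.trans (by linarith)
  · obtain ⟨k, hk, hkn, hbound⟩ : ∃ k : ℕ, 1 ≤ k ∧ n ≤ 3 * k ∧
        econvPow m₂ n (x⁻¹ * y) ≤ normSq (econvPow m₂ k) := by
      have hself : ∀ k g, econvPow m₂ (k + k) g ≤ normSq (econvPow m₂ k) := fun k g => by
        rw [econvPow_add]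
        exact econv_self_le_normSq _ g
      obtain ⟨k, rfl | rfl⟩ := n.even_or_odd'
      · exact ⟨k, by omega, by omega, two_mul k ▸ hself k _⟩
      · refine ⟨k, by omega, by omega, ?_⟩
        rw [two_mul, econvPow]
        simpa [h₂] using econv_le_of_le_left (m := m₂) (hself k) (x⁻¹ * y)
    have hkn' : (n : ℝ) ≤ 3 * k := by exact_mod_cast hkn
    calc (econvPow m₂ n (x⁻¹ * y)).toReal
        ≤ (normSq (econvPow m₂ k)).toReal := ENNReal.toReal_mono (hfin k) hbound
      _ ≤ (κ * k) ^ (-(d / 2)) := hnorm k hk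
      _ ≤ (κ / 3 * n) ^ (-(d / 2)) := by
          refine Real.rpow_le_rpow_of_nonpos (by positivity) ?_ (by linarith)
          calc κ / 3 * n ≤ κ / 3 * (3 * k) := by gcongr
            _ = κ * k := by ring
      _ = (κ / 3) ^ (-(d / 2)) * (n : ℝ) ^ (-(d / 2)) :=
          Real.mul_rpow (by positivity) hn0.le
      _ ≤ (1 + (κ / 3) ^ (-(d / 2))) * (n : ℝ) ^ (-(d / 2)) := by
          gcongr
          linarith


end RW
end

section
/- Let μ be a probability measure on a countable group G with H(μ) < ∞ and h(μ) = 0. Let {μ_k}_{k≥1} be probability measures on G with H(μ_k) < ∞ for all k, H(μ_k) → H(μ), and μ_k(g) → μ(g) for each g ∈ G. Then for every ε > 0 there exist K, T ≥ 1 such that for all k ≥ K and all n ≥ t₀ ≥ T, the Shannon entropy of the law under P_{μ_k} of the t₀-coarse trajectory satisfies H_{μ_k}(𝒫_n^{t₀}) < ε n. -/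
open Filter

namespace RW


variable {G : Type*} [Group G]

/-- Image of a weight function `p` under `f`. -/
noncomputable def push {X Y : Type*} (p : X → ℝ) (f : X → Y) : Y → ℝ :=
  fun y => ∑' x, Set.indicator {x | f x = y} p x

/-- Product of two weight functions. -/
def prodWeight {X Y : Type*} (p : X → ℝ) (q : Y → ℝ) : X × Y → ℝ := fun z => p z.1 * q z.2

/-- Joint weight of `n` independent increments. -/
def iidWeight {X : Type*} (p : X → ℝ) (n : ℕ) : (Fin n → X) → ℝ := fun v => ∏ i, p (v i)

/-- `p` is a probability mass function on a set without algebraic structure. -/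
def IsPMF {X : Type*} (p : X → ℝ) : Prop := (∀ x, 0 ≤ p x) ∧ HasSum p 1

section Push

variable {X Y Z W : Type*}

theorem hasSum_push {p : X → ℝ} {a : ℝ} (hp : HasSum p a) (f : X → Y) :
    HasSum (push p f) a := by
  have h := hp.tsum_fiberwise f
  simp only [tsum_subtype] at h
  exact h

theorem IsPMF.push {p : X → ℝ} (hp : IsPMF p) (f : X → Y) : IsPMF (push p f) :=
  ⟨fun _ => tsum_nonneg fun x => Set.indicator_nonneg (fun x _ => hp.1 x) x, hasSum_push hp.2 f⟩

theorem IsPMF.le_one {p : X → ℝ} (hp : IsPMF p) (x : X) : p x ≤ 1 :=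
  le_hasSum hp.2 x fun y _ => hp.1 y

theorem IsPMF.le_push {p : X → ℝ} (hp : IsPMF p) (f : X → Y) (x : X) :
    p x ≤ RW.push p f (f x) := by
  have h := (hp.2.summable.indicator {z | f z = f x}).le_tsum x
    fun y _ => Set.indicator_nonneg (fun x _ => hp.1 x) y
  simpa [RW.push] using h

theorem push_comp {p : X → ℝ} (hp : Summable p) (f : X → Y) (g : Y → Z) :
    push (push p f) g = push p (g ∘ f) := by
  funext z
  have h := (hasSum_push (hp.indicator {x | g (f x) = z}).hasSum f).tsum_eq
  change _ = ∑' x, Set.indicator {x | g (f x) = z} p x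
  rw [← h]
  refine tsum_congr fun y => ?_
  by_cases hy : g y = z
  · rw [Set.indicator_of_mem (by exact hy)]
    refine tsum_congr fun x => ?_
    by_cases hx : f x = y
    · subst hx; simp [hy]
    · simp [hx]
  · rw [Set.indicator_of_notMem (by exact hy)]
    symm
    refine (tsum_congr fun x => ?_).trans tsum_zero
    by_cases hx : f x = y
    · subst hx; simp [hy]
    · simp [hx]

theorem push_equiv_apply (p : X → ℝ) (e : X ≃ Y) (x : X) : push p e (e x) = p x := by
  unfold push
  rw [tsum_eq_single x]
  · simp
  · intro z hz
    simp [hz]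

theorem IsPMF.prodWeight {p : X → ℝ} {q : Y → ℝ} (hp : IsPMF p) (hq : IsPMF q) :
    IsPMF (prodWeight p q) := by
  refine ⟨fun z => mul_nonneg (hp.1 _) (hq.1 _), ?_⟩
  have h := hp.2.mul hq.2 (hp.2.summable.mul_of_nonneg hq.2.summable hp.1 hq.1)
  rwa [mul_one] at h

theorem push_prodWeight {p : X → ℝ} {q : Y → ℝ} (hp : IsPMF p) (hq : IsPMF q)
    (f : X → Z) (g : Y → W) :
    push (prodWeight p q) (Prod.map f g) = prodWeight (push p f) (push q g) := by
  funext ⟨z, w⟩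
  have hp' := hp.2.summable.indicator {x | f x = z}
  have hq' := hq.2.summable.indicator {y | g y = w}
  have h := hp'.tsum_mul_tsum hq' (hp'.mul_of_nonneg hq'
    (fun x => Set.indicator_nonneg (fun x _ => hp.1 x) x)
    (fun x => Set.indicator_nonneg (fun x _ => hq.1 x) x))
  change _ = (∑' x, Set.indicator {x | f x = z} p x) * (∑' y, Set.indicator {y | g y = w} q y)
  rw [h]
  refine tsum_congr fun ⟨x, y⟩ => ?_
  by_cases hx : f x = z <;> by_cases hy : g y = w <;> simp [hx, hy, prodWeight]

theorem hasSum_negMulLog_prodWeight {p : X → ℝ} {q : Y → ℝ} (hp : IsPMF p) (hq : IsPMF q)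
    {a b : ℝ} (ha : HasSum (fun x => Real.negMulLog (p x)) a)
    (hb : HasSum (fun y => Real.negMulLog (q y)) b) :
    HasSum (fun z => Real.negMulLog (prodWeight p q z)) (a + b) := by
  have hp0 : ∀ x, 0 ≤ Real.negMulLog (p x) := fun x =>
    Real.negMulLog_nonneg (hp.1 x) (hp.le_one x)
  have hq0 : ∀ x, 0 ≤ Real.negMulLog (q x) := fun x =>
    Real.negMulLog_nonneg (hq.1 x) (hq.le_one x)
  have h1 := ha.mul hq.2 (ha.summable.mul_of_nonneg hq.2.summable hp0 hq.1)
  have h2 := hp.2.mul hb (hp.2.summable.mul_of_nonneg hb.summable hp.1 hq0)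
  rw [mul_one] at h1
  rw [one_mul] at h2
  refine (h1.add h2).congr_fun fun z => ?_
  rw [prodWeight, Real.negMulLog_mul]
  ring

theorem IsPMF.neg_log_push_mem {p : X → ℝ} (hp : IsPMF p) (f : X → Y) (x : X) :
    0 ≤ p x * -Real.log (RW.push p f (f x)) ∧
      p x * -Real.log (RW.push p f (f x)) ≤ Real.negMulLog (p x) := by
  have hle := hp.le_push f x
  have h0 := hp.1 x
  constructor
  · exact mul_nonneg h0 (neg_nonneg.2 (Real.log_nonpos (h0.trans hle) ((hp.push f).le_one _)))
  · rcases h0.eq_or_lt with h | h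
    · simp [← h]
    · have := Real.log_le_log h hle
      rw [Real.negMulLog]
      nlinarith

/-- Entropy of an image as an expectation over the original space. -/
theorem hasSum_negMulLog_push {p : X → ℝ} (hp : IsPMF p)
    (hs : Summable fun x => Real.negMulLog (p x)) (f : X → Y) :
    HasSum (fun y => Real.negMulLog (push p f y))
      (∑' x, p x * -Real.log (push p f (f x))) := by
  have hsum : Summable fun x => p x * -Real.log (push p f (f x)) :=
    hs.of_nonneg_of_le (fun x => (hp.neg_log_push_mem f x).1)
      fun x => (hp.neg_log_push_mem f x).2
  convert hasSum_push hsum.hasSum f using 2 with y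
  rw [Real.negMulLog, neg_mul, ← mul_neg]
  nth_rewrite 1 [push]
  rw [← tsum_mul_right]
  refine tsum_congr fun x => ?_
  by_cases hx : f x = y
  · subst hx; simp
  · simp [hx]

theorem tsum_negMulLog_push_le {p : X → ℝ} (hp : IsPMF p)
    (hs : Summable fun x => Real.negMulLog (p x)) (f : X → Y) :
    ∑' y, Real.negMulLog (push p f y) ≤ ∑' x, Real.negMulLog (p x) := by
  rw [(hasSum_negMulLog_push hp hs f).tsum_eq]
  exact (hs.of_nonneg_of_le (fun x => (hp.neg_log_push_mem f x).1)
      fun x => (hp.neg_log_push_mem f x).2).tsum_le_tsum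
        (fun x => (hp.neg_log_push_mem f x).2) hs

/-- Dominated convergence for series, with dominating series that vary along the sequence. -/
theorem tendsto_tsum_of_varying_bound {a b : ℕ → X → ℝ} {a' b' : X → ℝ}
    (ha : ∀ k, Summable (a k)) (ha' : Summable a')
    (hb : ∀ k x, 0 ≤ b k x) (hba : ∀ k x, b k x ≤ a k x)
    (hla : ∀ x, Tendsto (fun k => a k x) atTop (nhds (a' x)))
    (hlb : ∀ x, Tendsto (fun k => b k x) atTop (nhds (b' x)))
    (hsum : Tendsto (fun k => ∑' x, a k x) atTop (nhds (∑' x, a' x))) :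
    Tendsto (fun k => ∑' x, b k x) atTop (nhds (∑' x, b' x)) := by
  have hb0 : ∀ x, 0 ≤ b' x := fun x => ge_of_tendsto' (hlb x) fun k => hb k x
  have hba' : ∀ x, b' x ≤ a' x := fun x => le_of_tendsto_of_tendsto' (hlb x) (hla x)
    fun k => hba k x
  have tail : ∀ {u v : X → ℝ}, Summable u → (∀ x, 0 ≤ v x) → (∀ x, v x ≤ u x) →
      ∀ F : Finset X, ∑ x ∈ F, v x ≤ ∑' x, v x ∧
        ∑' x, v x - ∑ x ∈ F, v x ≤ ∑' x, u x - ∑ x ∈ F, u x := by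
    intro u v hu h0 huv F
    have hv : Summable v := hu.of_nonneg_of_le h0 huv
    refine ⟨hv.sum_le_tsum F fun x _ => h0 x, ?_⟩
    have h := (hu.sub hv).sum_le_tsum F fun x _ => sub_nonneg.2 (huv x)
    rw [hu.tsum_sub hv, Finset.sum_sub_distrib] at h
    linarith
  rw [Metric.tendsto_atTop']
  intro ε hε
  obtain ⟨F, hF⟩ := (ha'.hasSum.eventually (lt_mem_nhds
    (show ∑' x, a' x - ε / 4 < ∑' x, a' x by linarith))).exists
  have h1 : Tendsto (fun k => ∑' x, a k x - ∑ x ∈ F, a k x) atTop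
      (nhds (∑' x, a' x - ∑ x ∈ F, a' x)) :=
    hsum.sub (tendsto_finsetSum F fun x _ => hla x)
  have h2 := Metric.tendsto_nhds.1 (tendsto_finsetSum F fun x _ => hlb x) (ε / 4) (by positivity)
  have h1' := h1.eventually (gt_mem_nhds (show _ < ε / 4 by linarith))
  obtain ⟨N, hN⟩ := eventually_atTop.1 (h1'.and h2)
  refine ⟨N, fun k hk => ?_⟩
  obtain ⟨h3, h4⟩ := hN k hk.le
  have t1 := tail (ha k) (hb k) (hba k) F
  have t2 := tail ha' hb0 hba' F
  rw [Real.dist_eq, abs_lt] at h4 ⊢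
  constructor <;> linarith [h4.1, h4.2, t1.1, t1.2, t2.1, t2.2]

theorem tendsto_entropy_push {p : ℕ → X → ℝ} {q : X → ℝ} (hp : ∀ k, IsPMF (p k)) (hq : IsPMF q)
    (hps : ∀ k, Summable fun x => Real.negMulLog (p k x))
    (hqs : Summable fun x => Real.negMulLog (q x))
    (hlim : ∀ x, Tendsto (fun k => p k x) atTop (nhds (q x)))
    (hent : Tendsto (fun k => ∑' x, Real.negMulLog (p k x)) atTop
      (nhds (∑' x, Real.negMulLog (q x)))) (f : X → Y) :
    Tendsto (fun k => ∑' y, Real.negMulLog (push (p k) f y)) atTop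
      (nhds (∑' y, Real.negMulLog (push q f y))) := by
  have hpush : ∀ y, Tendsto (fun k => push (p k) f y) atTop (nhds (push q f y)) := by
    intro y
    refine tendsto_tsum_of_varying_bound (fun k => (hp k).2.summable) hq.2.summable
      (fun k x => Set.indicator_nonneg (fun x _ => (hp k).1 x) x)
      (fun k x => Set.indicator_le_self' (fun x _ => (hp k).1 x) x) hlim ?_ ?_
    · intro x
      by_cases hx : f x = y
      · simpa [hx] using hlim x
      · simp [hx]
    · simp only [(hp _).2.tsum_eq, hq.2.tsum_eq, tendsto_const_nhds]
  have hloga : ∀ x, Tendsto (fun k => Real.negMulLog (p k x)) atTop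
      (nhds (Real.negMulLog (q x))) := fun x =>
    (Real.continuous_negMulLog.tendsto _).comp (hlim x)
  simp only [(hasSum_negMulLog_push (hp _) (hps _) f).tsum_eq,
    (hasSum_negMulLog_push hq hqs f).tsum_eq]
  refine tendsto_tsum_of_varying_bound hps hqs (fun k x => ((hp k).neg_log_push_mem f x).1)
    (fun k x => ((hp k).neg_log_push_mem f x).2) hloga ?_ hent
  intro x
  rcases (hq.1 x).eq_or_lt with h | h
  · have h0 := hloga x
    rw [← h, Real.negMulLog_zero] at h0
    rw [← h, zero_mul]
    exact squeeze_zero (fun k => ((hp k).neg_log_push_mem f x).1)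
      (fun k => ((hp k).neg_log_push_mem f x).2) h0
  · exact (hlim x).mul (((hpush (f x)).log (h.trans_le (hq.le_push f x)).ne').neg)

theorem iidWeight_cons (p : X → ℝ) (n : ℕ) (z : X × (Fin n → X)) :
    iidWeight p (n + 1) (Fin.consEquiv (fun _ => X) z) = prodWeight p (iidWeight p n) z := by
  simp [iidWeight, prodWeight, Fin.prod_univ_succ, Fin.consEquiv]

theorem IsPMF.iidWeight {p : X → ℝ} (hp : IsPMF p) (n : ℕ) : IsPMF (iidWeight p n) := by
  refine ⟨fun v => Finset.prod_nonneg fun i _ => hp.1 _, ?_⟩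
  induction n with
  | zero => simpa [RW.iidWeight] using hasSum_unique (RW.iidWeight p 0)
  | succ n ih =>
    rw [← (Fin.consEquiv fun _ : Fin (n + 1) => X).hasSum_iff]
    have h : IsPMF (RW.iidWeight p n) := ⟨fun v => Finset.prod_nonneg fun i _ => hp.1 _, ih⟩
    convert (hp.prodWeight h).2 using 1
    funext z
    exact iidWeight_cons p n z

theorem hasSum_negMulLog_iidWeight {p : X → ℝ} (hp : IsPMF p)
    (hs : Summable fun x => Real.negMulLog (p x)) (n : ℕ) :
    HasSum (fun v => Real.negMulLog (iidWeight p n v)) (n * ∑' x, Real.negMulLog (p x)) := by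
  induction n with
  | zero => simp [iidWeight]
  | succ n ih =>
    rw [← (Fin.consEquiv fun _ : Fin (n + 1) => X).hasSum_iff]
    convert hasSum_negMulLog_prodWeight hp (hp.iidWeight n) hs.hasSum ih using 1
    · funext z
      simp only [Function.comp_apply, iidWeight_cons]
    · push_cast; ring

theorem push_append (p : X → ℝ) (a b : ℕ) :
    push (prodWeight (iidWeight p a) (iidWeight p b)) (fun z => Fin.append z.1 z.2) =
      iidWeight p (a + b) := by
  funext v
  obtain ⟨z, rfl⟩ := (Fin.appendEquiv a b).surjective v
  refine (push_equiv_apply _ (Fin.appendEquiv a b) z).trans ?_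
  simp [iidWeight, prodWeight, Fin.prod_univ_add, Fin.appendEquiv]

/-- A statistic of `a + b` independent increments that is a function of a statistic of the first
`a` and a statistic of the last `b`. -/
theorem push_iidWeight_add {p : X → ℝ} (hp : IsPMF p) {a b : ℕ} {Y₁ Y₂ : Type*}
    (f : (Fin a → X) → Y₁) (g : (Fin b → X) → Y₂) (Φ : Y₁ × Y₂ → Z)
    (F : (Fin (a + b) → X) → Z) (hF : ∀ u w, F (Fin.append u w) = Φ (f u, g w)) :
    push (iidWeight p (a + b)) F =
      push (prodWeight (push (iidWeight p a) f) (push (iidWeight p b) g)) Φ := by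
  have hs := ((hp.iidWeight a).prodWeight (hp.iidWeight b)).2.summable
  rw [← push_prodWeight (hp.iidWeight a) (hp.iidWeight b), push_comp hs, ← push_append,
    push_comp hs]
  congr 1
  funext z
  exact hF z.1 z.2

end Push

theorem walk_add (gs : ℕ → G) (a m : ℕ) :
    walk gs (a + m) = walk gs a * walk (fun i => gs (a + i)) m := by
  simp [walk, List.range_add, List.map_map, Function.comp_def]

theorem walk_congr {gs gs' : ℕ → G} {m : ℕ} (h : ∀ i < m, gs i = gs' i) :
    walk gs m = walk gs' m := by
  unfold walk
  congr 1
  exact List.map_congr_left fun i hi => h i (List.mem_range.1 hi)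

theorem walk_pad_append {a b : ℕ} (u : Fin a → G) (w : Fin b → G) (m : ℕ) :
    walk (pad (Fin.append u w)) (a + m) = walk (pad u) a * walk (pad w) m := by
  rw [walk_add]
  congr 1
  · refine walk_congr fun i hi => ?_
    have h : (⟨i, by omega⟩ : Fin (a + b)) = Fin.castAdd b ⟨i, hi⟩ := rfl
    simp only [pad, hi, dif_pos, show i < a + b by omega]
    rw [h, Fin.append_left]
  · refine walk_congr fun i _ => ?_
    by_cases hi : i < b
    · have h : (⟨a + i, by omega⟩ : Fin (a + b)) = Fin.natAdd a ⟨i, hi⟩ := rfl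
      simp only [pad, hi, dif_pos, show a + i < a + b by omega]
      rw [h, Fin.append_right]
    · simp [pad, hi]

theorem conv_eq_push (p q : G → ℝ) :
    conv p q = push (prodWeight p q) (fun z => z.1 * z.2) := by
  funext g
  have hinj : Function.Injective fun h : G => (g * h⁻¹, h) := fun h h' hh =>
    (Prod.ext_iff.1 hh).2
  unfold conv push
  rw [← hinj.tsum_eq]
  · exact tsum_congr fun h => by simp [prodWeight]
  · rintro ⟨x, y⟩ hxy
    refine ⟨y, ?_⟩
    have h := (Set.indicator_apply_ne_zero.1 hxy).1
    simp only [Set.mem_ofPred_eq] at h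
    simp [← h]

theorem push_walk_add {μ : G → ℝ} (hμ : IsPMF μ) (a b : ℕ) :
    push (iidWeight μ (a + b)) (fun v => walk (pad v) (a + b)) =
      conv (push (iidWeight μ a) (fun v => walk (pad v) a))
        (push (iidWeight μ b) (fun v => walk (pad v) b)) := by
  rw [conv_eq_push]
  exact push_iidWeight_add hμ _ _ _ _ fun u w => walk_pad_append u w b

theorem convPow_eq_push {μ : G → ℝ} (hμ : IsPMF μ) (n : ℕ) :
    convPow μ n = push (iidWeight μ n) (fun v => walk (pad v) n) := by
  induction n with
  | zero =>
    funext g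
    by_cases hg : g = 1 <;> simp [convPow, push, walk, iidWeight, hg, eq_comm]
  | succ n ih =>
    rw [push_walk_add hμ, ← ih, convPow]
    congr 1
    funext g
    obtain ⟨x, rfl⟩ := (Equiv.funUnique (Fin 1) G).surjective g
    have h : (fun v : Fin 1 → G => walk (pad v) 1) = Equiv.funUnique (Fin 1) G := by
      funext v
      simp [walk, pad]
    rw [h, push_equiv_apply]
    simp [iidWeight]

theorem isPMF_convPow {μ : G → ℝ} (hμ : IsPMF μ) (n : ℕ) : IsPMF (convPow μ n) := by
  rw [convPow_eq_push hμ]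
  exact (hμ.iidWeight n).push _

theorem finiteEntropy_convPow_s10 {μ : G → ℝ} (hμ : IsPMF μ) (hs : FiniteEntropy μ) (n : ℕ) :
    FiniteEntropy (convPow μ n) := by
  rw [convPow_eq_push hμ]
  exact (hasSum_negMulLog_push (hμ.iidWeight n)
    (hasSum_negMulLog_iidWeight hμ hs n).summable _).summable

theorem entropy_convPow_nonneg {μ : G → ℝ} (hμ : IsPMF μ) (n : ℕ) :
    0 ≤ entropy (convPow μ n) :=
  tsum_nonneg fun g => Real.negMulLog_nonneg ((isPMF_convPow hμ n).1 g)
    ((isPMF_convPow hμ n).le_one g)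

theorem entropy_convPow_le {μ : G → ℝ} (hμ : IsPMF μ) (hs : FiniteEntropy μ) (n : ℕ) :
    entropy (convPow μ n) ≤ n * entropy μ := by
  have h := hasSum_negMulLog_iidWeight hμ hs n
  rw [convPow_eq_push hμ]
  exact (tsum_negMulLog_push_le (hμ.iidWeight n) h.summable _).trans_eq h.tsum_eq

theorem entropy_convPow_add_le {μ : G → ℝ} (hμ : IsPMF μ) (hs : FiniteEntropy μ) (a b : ℕ) :
    entropy (convPow μ (a + b)) ≤ entropy (convPow μ a) + entropy (convPow μ b) := by
  have h := hasSum_negMulLog_prodWeight (isPMF_convPow hμ a) (isPMF_convPow hμ b)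
    (finiteEntropy_convPow_s10 hμ hs a).hasSum (finiteEntropy_convPow_s10 hμ hs b).hasSum
  rw [convPow_eq_push hμ (a + b), push_walk_add hμ, ← convPow_eq_push hμ, ← convPow_eq_push hμ,
    conv_eq_push]
  exact (tsum_negMulLog_push_le ((isPMF_convPow hμ a).prodWeight (isPMF_convPow hμ b))
    h.summable _).trans_eq h.tsum_eq

theorem entropy_convPow_mul_add_le {μ : G → ℝ} (hμ : IsPMF μ) (hs : FiniteEntropy μ)
    (m q r : ℕ) :
    entropy (convPow μ (m * q + r)) ≤ q * entropy (convPow μ m) + r * entropy μ := by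
  induction q with
  | zero => simpa using entropy_convPow_le hμ hs r
  | succ q ih =>
    have h := entropy_convPow_add_le hμ hs m (m * q + r)
    rw [show m * (q + 1) + r = m + (m * q + r) by ring]
    push_cast
    linarith

theorem tendsto_entropy_convPow {μ : G → ℝ} (hμ : IsPMF μ) (hs : FiniteEntropy μ)
    {μk : ℕ → G → ℝ} (hμk : ∀ k, IsPMF (μk k)) (hsk : ∀ k, FiniteEntropy (μk k))
    (hent : Tendsto (fun k => entropy (μk k)) atTop (nhds (entropy μ)))
    (hpt : ∀ g : G, Tendsto (fun k => μk k g) atTop (nhds (μ g))) (n : ℕ) :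
    Tendsto (fun k => entropy (convPow (μk k) n)) atTop (nhds (entropy (convPow μ n))) := by
  simp only [convPow_eq_push hμ, convPow_eq_push (hμk _)]
  refine tendsto_entropy_push (fun k => (hμk k).iidWeight n) (hμ.iidWeight n)
    (fun k => (hasSum_negMulLog_iidWeight (hμk k) (hsk k) n).summable)
    (hasSum_negMulLog_iidWeight hμ hs n).summable
    (fun v => tendsto_finsetProd _ fun i _ => hpt (v i)) ?_ _
  simp only [(hasSum_negMulLog_iidWeight (hμk _) (hsk _) n).tsum_eq,
    (hasSum_negMulLog_iidWeight hμ hs n).tsum_eq]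
  exact hent.const_mul _

/-- The walk observed at the times `t, 2t, …, qt` has entropy at most `q H(μ^{*t})`. -/
theorem entropy_walk_multiples_le {μ : G → ℝ} (hμ : IsPMF μ) (hs : FiniteEntropy μ)
    (t q N : ℕ) (hN : q * t ≤ N) :
    ∑' c, Real.negMulLog (push (iidWeight μ N)
      (fun v (j : Fin q) => walk (pad v) ((j.1 + 1) * t)) c) ≤ q * entropy (convPow μ t) := by
  induction q generalizing N with
  | zero =>
    have h := ((hμ.iidWeight N).push fun v (j : Fin 0) => walk (pad v) ((j.1 + 1) * t)).2.tsum_eq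
    rw [tsum_fintype, Fintype.sum_unique] at h ⊢
    simp [h]
  | succ q ih =>
    obtain ⟨r, rfl⟩ : ∃ r, N = t + r := ⟨N - t, by
      have : t ≤ (q + 1) * t := Nat.le_mul_of_pos_left t q.succ_pos
      omega⟩
    have hr : q * t ≤ r := by rw [add_mul] at hN; omega
    rw [push_iidWeight_add hμ (fun u => walk (pad u) t)
      (fun w (j : Fin q) => walk (pad w) ((j.1 + 1) * t))
      (fun z => (Fin.cons z.1 fun j => z.1 * z.2 j : Fin (q + 1) → G)), ← convPow_eq_push hμ]
    · have hr' := (hμ.iidWeight r).push fun w (j : Fin q) => walk (pad w) ((j.1 + 1) * t)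
      have h := hasSum_negMulLog_prodWeight (isPMF_convPow hμ t) hr'
        (finiteEntropy_convPow_s10 hμ hs t).hasSum
        (hasSum_negMulLog_push (hμ.iidWeight r)
          (hasSum_negMulLog_iidWeight hμ hs r).summable _).summable.hasSum
      refine (tsum_negMulLog_push_le ((isPMF_convPow hμ t).prodWeight hr')
        h.summable _).trans ?_
      rw [h.tsum_eq, show ((q + 1 : ℕ) : ℝ) * entropy (convPow μ t) =
        entropy (convPow μ t) + q * entropy (convPow μ t) by push_cast; ring]
      exact add_le_add le_rfl (ih r hr)
    · intro u w
      funext j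
      refine Fin.cases ?_ (fun j => ?_) j
      · simpa [walk] using walk_pad_append u w 0
      · rw [Fin.cons_succ, ← walk_pad_append u w, Fin.val_succ]
        congr 1
        ring

theorem coarse_trajectory_small_entropy
    {G : Type*} [Group G] [Countable G]
    (μ : G → ℝ) (hμ : IsProb μ) (hH : FiniteEntropy μ) (hh0 : asympEntropy μ = 0)
    (μk : ℕ → G → ℝ) (hμk : ∀ k, IsProb (μk k)) (hHk : ∀ k, FiniteEntropy (μk k))
    (hent : Tendsto (fun k => entropy (μk k)) atTop (nhds (entropy μ)))
    (hpt : ∀ g : G, Tendsto (fun k => μk k g) atTop (nhds (μ g))) :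
    ∀ ε : ℝ, 0 < ε → ∃ K T : ℕ, 1 ≤ K ∧ 1 ≤ T ∧
      ∀ k, K ≤ k → ∀ t₀ n : ℕ, T ≤ t₀ → t₀ ≤ n →
        entropyRV (μk k) n (coarseTraj t₀ n) < ε * n := by
  intro ε hε
  have hμ' : IsPMF μ := hμ
  have hH0 : 0 ≤ entropy μ := tsum_nonneg fun g =>
    Real.negMulLog_nonneg (hμ'.1 g) (hμ'.le_one g)
  obtain ⟨m, hm, hm1⟩ : ∃ m : ℕ, entropy (convPow μ m) / m < ε / 4 ∧ 1 ≤ m := by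
    have hb : IsBoundedUnder (· ≤ ·) atTop
        (fun n : ℕ => entropy (convPow μ n) / (n : ℝ)) := by
      refine isBoundedUnder_of ⟨entropy μ, fun n => ?_⟩
      exact div_le_of_le_mul₀ n.cast_nonneg hH0
        ((entropy_convPow_le hμ' hH n).trans_eq (mul_comm _ _))
    have hlt : asympEntropy μ < ε / 4 := by rw [hh0]; positivity
    exact ((eventually_lt_of_limsup_lt hlt hb).and (eventually_ge_atTop 1)).exists
  have hm0 : (0 : ℝ) < m := by exact_mod_cast hm1
  rw [div_lt_iff₀ hm0] at hm
  obtain ⟨K, hK⟩ := eventually_atTop.1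
    (((tendsto_entropy_convPow hμ' hH hμk hHk hent hpt m).eventually (gt_mem_nhds hm)).and
      (hent.eventually (gt_mem_nhds (lt_add_one (entropy μ)))))
  obtain ⟨T, hT⟩ := exists_nat_gt (m * (entropy μ + 1) / (ε / 4))
  rw [div_lt_iff₀ (by positivity)] at hT
  refine ⟨max K 1, max T 1, le_max_right _ _, le_max_right _ _, fun k hk t n ht htn => ?_⟩
  obtain ⟨h1, h2⟩ := hK k ((le_max_left _ _).trans hk)
  have hTt : (T : ℝ) ≤ t := by exact_mod_cast (le_max_left _ _).trans ht
  have ht0 : (0 : ℝ) < t := by exact_mod_cast (le_max_right T 1).trans ht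
  have hconv : entropy (convPow (μk k) t) ≤ ε / 2 * t := by
    have h := entropy_convPow_mul_add_le (hμk k) (hHk k) m (t / m) (t % m)
    rw [Nat.div_add_mod] at h
    have hr : ((t % m : ℕ) : ℝ) ≤ m := by exact_mod_cast (Nat.mod_lt t hm1).le
    have hq : ((t / m : ℕ) : ℝ) * m ≤ t := by exact_mod_cast Nat.div_mul_le_self t m
    have e1 : ((t / m : ℕ) : ℝ) * entropy (convPow (μk k) m) ≤ ε / 4 * t := by
      calc _ ≤ ((t / m : ℕ) : ℝ) * (ε / 4 * m) := by gcongr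
        _ = ε / 4 * (((t / m : ℕ) : ℝ) * m) := by ring
        _ ≤ _ := by gcongr
    have e2 : ((t % m : ℕ) : ℝ) * entropy (μk k) ≤ m * (entropy μ + 1) := by
      calc _ ≤ ((t % m : ℕ) : ℝ) * (entropy μ + 1) := by gcongr
        _ ≤ _ := by gcongr
    have e3 : (T : ℝ) * (ε / 4) ≤ t * (ε / 4) := by gcongr
    linarith
  have hq : ((n / t : ℕ) : ℝ) * t ≤ n := by exact_mod_cast Nat.div_mul_le_self n t
  have hn0 : (0 : ℝ) < n := ht0.trans_le (by exact_mod_cast htn)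
  calc entropyRV (μk k) n (coarseTraj t n)
      ≤ ((n / t : ℕ) : ℝ) * entropy (convPow (μk k) t) :=
        entropy_walk_multiples_le (hμk k) (hHk k) t (n / t) n (Nat.div_mul_le_self n t)
    _ ≤ ((n / t : ℕ) : ℝ) * (ε / 2 * t) := by gcongr
    _ = ε / 2 * (((n / t : ℕ) : ℝ) * t) := by ring
    _ ≤ ε / 2 * n := by gcongr
    _ < ε * n := by nlinarith

end RW
end
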